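/- arXiv:1511.02374 — 2 statements merged into one kernel-verified Lean document; each statement's English description precedes it below -/
import Mathlib

section
/- Let D = Z_3 × Z_{3^n} (n ≥ 2), A an S-ring over D, c₁ a fixed element of order 3 in the Z_{3^n} factor, and T_{c₁} the basic set of A containing c₁. If T_{c₁} is not regular (i.e., contains elements of at least two distinct orders), then T_{c₁} is rational, i.e., T_{c₁}^{(m)} = T_{c₁} for all integers m coprime to 3. -/
open scoped BigOperators Pointwise Classical

noncomputable section

/-- The group-ring element `X̄ = Σ_{x∈X} x` in `ℤG`. -/
def ind {G : Type*} [Group G] (X : Finset G) : MonoidAlgebra ℤ G :=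
  ∑ x ∈ X, MonoidAlgebra.single x 1

/-- The ℤ-span of the class sums of the members of `S`. -/
def spanA {G : Type*} [Group G] (S : Finset (Finset G)) :
    Submodule ℤ (MonoidAlgebra ℤ G) :=
  Submodule.span ℤ (ind '' (S : Set (Finset G)))

/-- `S` is the partition of basic sets of an S-ring over `G`. -/
structure IsSRing {G : Type*} [Group G] (S : Finset (Finset G)) : Prop where
  cover : ∀ g : G, ∃ X ∈ S, g ∈ X
  disj : ∀ X ∈ S, ∀ Y ∈ S, X ≠ Y → Disjoint X Y
  nonempty : ∀ X ∈ S, X.Nonempty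
  one_mem : ({1} : Finset G) ∈ S
  inv_mem : ∀ X ∈ S, X.image (·⁻¹) ∈ S
  mul_closed : ∀ a ∈ spanA S, ∀ b ∈ spanA S, a * b ∈ spanA S

/-- `X` is an `A`-set: its class sum lies in the span of the basic class sums. -/
def IsASet {G : Type*} [Group G] (S : Finset (Finset G)) (X : Finset G) : Prop :=
  ind X ∈ spanA S

/-- The finset underlying a subgroup of a finite group. -/
def subgroupFinset {G : Type*} [Group G] [Fintype G] (H : Subgroup G) : Finset G :=
  Finset.univ.filter (· ∈ H)

/-- `H` is an `A`-subgroup. -/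
def IsASubgroup {G : Type*} [Group G] [Fintype G] (S : Finset (Finset G))
    (H : Subgroup G) : Prop :=
  IsASet S (subgroupFinset H)

/-- The radical `rad(X) = {g : gX = Xg = X}` as a subgroup. -/
def radSubgroup {G : Type*} [Group G] (X : Finset G) : Subgroup G where
  carrier := {g : G | X.image (g * ·) = X ∧ X.image (· * g) = X}
  one_mem' := by
    constructor <;> · simp only [one_mul, mul_one]; exact Finset.image_id
  mul_mem' := by
    rintro a b ⟨ha1, ha2⟩ ⟨hb1, hb2⟩
    constructor
    · have : X.image (a * b * ·) = (X.image (b * ·)).image (a * ·) := by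
        rw [Finset.image_image]
        exact Finset.image_congr (fun x _ => by simp [mul_assoc])
      rw [this, hb1, ha1]
    · have : X.image (· * (a * b)) = (X.image (· * a)).image (· * b) := by
        rw [Finset.image_image]
        exact Finset.image_congr (fun x _ => by simp [mul_assoc])
      rw [this, ha2, hb2]
  inv_mem' := by
    rintro a ⟨ha1, ha2⟩
    constructor
    · have := congrArg (Finset.image (a⁻¹ * ·)) ha1
      rw [Finset.image_image] at this
      have h2 : X.image ((a⁻¹ * ·) ∘ (a * ·)) = X := by
        rw [show ((a⁻¹ * ·) ∘ (a * ·)) = id by funext x; simp, Finset.image_id]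
      rw [← this, h2]
    · have := congrArg (Finset.image (· * a⁻¹)) ha2
      rw [Finset.image_image] at this
      have h2 : X.image ((· * a⁻¹) ∘ (· * a)) = X := by
        rw [show ((· * a⁻¹) ∘ (· * a)) = id by funext x; simp, Finset.image_id]
      rw [← this, h2]

end

instance nePow (a k : ℕ) [NeZero a] : NeZero (a ^ k) := ⟨pow_ne_zero k (NeZero.ne a)⟩

/-- The group `D = ℤ₃ × ℤ_{3^n}` (written multiplicatively). -/
abbrev Dgrp (n : ℕ) := Multiplicative (ZMod 3) × Multiplicative (ZMod (3 ^ n))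


section Helpers
open scoped Classical

theorem ind_coeff {G : Type*} [Group G] (X : Finset G) (g : G) :
    (ind X).coeff g = if g ∈ X then 1 else 0 := by
  simp [ind, MonoidAlgebra.coeff_sum, Finsupp.single_apply]

theorem spanA_const {G : Type*} [Group G] {S : Finset (Finset G)} (hS : IsSRing S)
    {a : MonoidAlgebra ℤ G} (ha : a ∈ spanA S) {Y : Finset G} (hY : Y ∈ S)
    {g h : G} (hg : g ∈ Y) (hh : h ∈ Y) : a.coeff g = a.coeff h := by
  unfold spanA at ha
  induction ha using Submodule.span_induction with
  | mem x hx =>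
    obtain ⟨X, hX, rfl⟩ := hx
    rw [ind_coeff, ind_coeff]
    by_cases hXY : X = Y
    · subst hXY; simp [hg, hh]
    · have hd := hS.disj X hX Y hY hXY
      rw [Finset.disjoint_right] at hd
      simp [hd hg, hd hh]
  | zero => simp
  | add x y _ _ hx hy => simp [hx, hy]
  | smul r x _ hx => rw [MonoidAlgebra.coeff_smul_apply, MonoidAlgebra.coeff_smul_apply, hx]

theorem ind_mem {G : Type*} [Group G] {S : Finset (Finset G)} {X : Finset G} (hX : X ∈ S) :
    ind X ∈ spanA S := Submodule.subset_span ⟨X, hX, rfl⟩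

theorem class_eq {G : Type*} [Group G] {S : Finset (Finset G)} (hS : IsSRing S)
    {X Y : Finset G} (hX : X ∈ S) (hY : Y ∈ S) {g : G} (hgX : g ∈ X) (hgY : g ∈ Y) : X = Y := by
  by_contra h
  exact Finset.disjoint_left.mp (hS.disj X hX Y hY h) hgX hgY

theorem inv_class {G : Type*} [Group G] {S : Finset (Finset G)} (hS : IsSRing S)
    {T : Finset G} (hT : T ∈ S) {x y : G} (hx : x ∈ T) (hxi : x⁻¹ ∈ T) (hy : y ∈ T) : y⁻¹ ∈ T := by
  have := class_eq hS (hS.inv_mem T hT) hT (g := x⁻¹) (Finset.mem_image_of_mem _ hx) hxi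
  rw [← this]
  exact Finset.mem_image_of_mem _ hy

theorem pow_mem_spanA {G : Type*} [Group G] {S : Finset (Finset G)} (hS : IsSRing S)
    {a : MonoidAlgebra ℤ G} (ha : a ∈ spanA S) (k : ℕ) : a ^ (k + 1) ∈ spanA S := by
  induction k with
  | zero => simpa using ha
  | succ k ih => rw [pow_succ]; exact hS.mul_closed _ ih _ ha

theorem schur_prime {G : Type*} [CommGroup G] {S : Finset (Finset G)} (hS : IsSRing S)
    {p : ℕ} [hp : Fact p.Prime] (hinj : Function.Injective (fun x : G => x ^ p))
    {X Y : Finset G} (hX : X ∈ S) (hY : Y ∈ S) {x : G} (hx : x ∈ X) (hxY : x ^ p ∈ Y)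
    {y : G} (hy : y ∈ Y) : ∃ z ∈ X, z ^ p = y := by
  have key : ∀ g : G, (((ind X ^ p).coeff g : ℤ) : ZMod p)
      = if ∃ z ∈ X, z ^ p = g then 1 else 0 := by
    intro g
    have : CharP (MonoidAlgebra (ZMod p) G) p :=
      charP_of_injective_algebraMap (algebraMap (ZMod p) (MonoidAlgebra (ZMod p) G)).injective p
    have h1 : (MonoidAlgebra.mapRingHom G (Int.castRingHom (ZMod p)) (ind X ^ p)).coeff g
        = (((ind X ^ p).coeff g : ℤ) : ZMod p) := by
      simp [-map_pow]
    rw [← h1, map_pow, ind, map_sum, sum_pow_char]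
    simp only [MonoidAlgebra.mapRingHom_single, MonoidAlgebra.single_pow, map_one, one_pow,
      MonoidAlgebra.coeff_sum, Finsupp.finsetSum_apply, MonoidAlgebra.coeff_single,
      Finsupp.single_apply]
    split_ifs with h
    · obtain ⟨z, hz, rfl⟩ := h
      rw [Finset.sum_eq_single z]
      · simp
      · intro b _ hb
        rw [if_neg]
        exact fun h => hb (hinj h)
      · intro h; exact absurd hz h
    · refine Finset.sum_eq_zero fun z hz => ?_
      rw [if_neg]
      exact fun h' => h ⟨z, hz, h'⟩
  have hmem : ind X ^ p ∈ spanA S := by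
    have := pow_mem_spanA hS (ind_mem hX) (p - 1)
    rwa [Nat.sub_add_cancel hp.out.one_le] at this
  have hc := spanA_const hS hmem hY hxY hy
  have h1 := key (x ^ p)
  have h2 := key y
  rw [if_pos ⟨x, hx, rfl⟩, hc, h2] at h1
  by_contra h
  rw [if_neg h] at h1
  exact zero_ne_one h1

theorem schur_mul {G : Type*} [CommGroup G] [Finite G] {S : Finset (Finset G)} (hS : IsSRing S)
    (m : ℕ) (hm : m.Coprime (Nat.card G)) (hm0 : m ≠ 0) :
    ∀ X ∈ S, ∀ Y ∈ S, ∀ x ∈ X, x ^ m ∈ Y → ∀ y ∈ Y, ∃ z ∈ X, z ^ m = y := by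
  induction m using Nat.recOnMul with
  | zero => exact absurd rfl hm0
  | one =>
    intro X hX Y hY x hx hxY y hy
    rw [pow_one] at hxY
    have := class_eq hS hX hY hx hxY
    subst this
    exact ⟨y, hy, pow_one y⟩
  | prime p hp =>
    intro X hX Y hY x hx hxY y hy
    have : Fact p.Prime := ⟨hp⟩
    exact schur_prime hS (powCoprime hm.symm).injective hX hY hx hxY hy
  | mul a b iha ihb =>
    intro X hX Y hY x hx hxY y hy
    have ha := iha (Nat.Coprime.coprime_mul_right hm) (by rintro rfl; simp at hm0)
    have hb := ihb (Nat.Coprime.coprime_mul_left hm) (by rintro rfl; simp at hm0)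
    obtain ⟨Z, hZ, hxZ⟩ := hS.cover (x ^ a)
    rw [pow_mul] at hxY
    obtain ⟨w, hw, rfl⟩ := hb Z hZ Y hY _ hxZ hxY y hy
    obtain ⟨z, hz, rfl⟩ := ha X hX Z hZ x hx hxZ w hw
    exact ⟨z, hz, pow_mul _ _ _⟩

theorem ind_mul_inv_coeff {G : Type*} [CommGroup G] (X : Finset G) (g : G) :
    (ind X * ind (X.image (·⁻¹))).coeff g = ((X.filter (fun t => g⁻¹ * t ∈ X)).card : ℤ) := by
  conv_lhs => rw [ind]
  rw [Finset.sum_mul, MonoidAlgebra.coeff_sum, Finsupp.finsetSum_apply]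
  simp only [MonoidAlgebra.coeff_single_mul_apply, ind_coeff, Finset.mem_image, one_mul]
  rw [Finset.card_filter]
  push_cast
  refine Finset.sum_congr rfl fun t _ => ?_
  congr 1
  apply propext
  constructor
  · rintro ⟨a, ha, h⟩
    have : a = g⁻¹ * t := by rw [← inv_inv a, h]; simp [mul_comm]
    rwa [← this]
  · intro h
    exact ⟨_, h, by simp [mul_comm]⟩

/-- The number of `t ∈ X` with `g⁻¹ t ∉ X` is constant for `g ∈ X`. -/
theorem deficit_const {G : Type*} [CommGroup G] {S : Finset (Finset G)} (hS : IsSRing S)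
    {X : Finset G} (hX : X ∈ S) {g h : G} (hg : g ∈ X) (hh : h ∈ X) :
    (X.filter (fun t => g⁻¹ * t ∉ X)).card = (X.filter (fun t => h⁻¹ * t ∉ X)).card := by
  have hc := spanA_const hS (hS.mul_closed _ (ind_mem hX) _ (ind_mem (hS.inv_mem X hX))) hX hg hh
  rw [ind_mul_inv_coeff, ind_mul_inv_coeff] at hc
  have h1 := Finset.card_filter_add_card_filter_not (s := X) (fun t => g⁻¹ * t ∈ X)
  have h2 := Finset.card_filter_add_card_filter_not (s := X) (fun t => h⁻¹ * t ∈ X)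
  omega

theorem cyc3 {C : Type*} [CommGroup C] [Finite C] [IsCyclic C] {c b : C} (hc : orderOf c = 3)
    (hb : b ^ 3 = 1) : b = 1 ∨ b = c ∨ b = c ^ 2 := by
  have := Fintype.ofFinite C
  have h3 := IsCyclic.card_pow_eq_one_le (α := C) (n := 3) (by norm_num)
  have hc3 : c ^ 3 = 1 := by rw [← hc]; exact pow_orderOf_eq_one c
  have hc1 : c ≠ 1 := by rintro rfl; simp at hc
  by_contra! hne
  obtain ⟨n1, n2, n3⟩ := hne
  have hc2 : c ^ 2 ≠ 1 := fun h => by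
    have := orderOf_dvd_of_pow_eq_one h
    rw [hc] at this; omega
  have hcc : c ^ 2 ≠ c := fun h => hc1 (by rw [pow_two] at h; exact mul_eq_left.mp h)
  have hsub : ({b, 1, c, c ^ 2} : Finset C) ⊆ Finset.univ.filter (fun a => a ^ 3 = 1) := by
    intro a ha
    simp only [Finset.mem_insert, Finset.mem_singleton] at ha
    simp only [Finset.mem_filter, Finset.mem_univ, true_and]
    rcases ha with rfl | rfl | rfl | rfl
    · exact hb
    · simp
    · exact hc3
    · rw [← pow_mul, mul_comm, pow_mul, hc3, one_pow]
  have h4 : ({b, 1, c, c ^ 2} : Finset C).card = 4 := by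
    rw [Finset.card_insert_of_notMem, Finset.card_insert_of_notMem,
      Finset.card_insert_of_notMem, Finset.card_singleton]
    · simpa using hcc.symm
    · simp [hc1.symm, hc2.symm]
    · simp [n1, n2, n3]
  have := Finset.card_le_card hsub
  omega

/-- In a cyclic 3-group, every nontrivial element has a power equal to a given order-3 element. -/
theorem exists_pow_eq {C : Type*} [CommGroup C] [Finite C] [IsCyclic C] {c y : C} {n : ℕ}
    (hcard : Nat.card C = 3 ^ n) (hc : orderOf c = 3) (hy : y ≠ 1) : ∃ k : ℕ, y ^ k = c := by
  have hd : orderOf y ∣ 3 ^ n := hcard ▸ orderOf_dvd_natCard y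
  obtain ⟨j, -, hj⟩ := (Nat.dvd_prime_pow Nat.prime_three).mp hd
  have hj0 : j ≠ 0 := by
    rintro rfl
    exact hy (orderOf_eq_one_iff.mp (by simpa using hj))
  obtain ⟨i, rfl⟩ := Nat.exists_eq_succ_of_ne_zero hj0
  have h1 : (y ^ 3 ^ i) ^ 3 = 1 := by
    rw [← pow_mul, ← pow_succ, ← Nat.succ_eq_add_one, ← hj]; exact pow_orderOf_eq_one y
  have h2 : y ^ 3 ^ i ≠ 1 := fun h => by
    have := orderOf_dvd_of_pow_eq_one h
    rw [hj, Nat.pow_dvd_pow_iff_le_right (by norm_num)] at this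
    omega
  have hc3 : c ^ 3 = 1 := by rw [← hc]; exact pow_orderOf_eq_one c
  rcases cyc3 hc h1 with h | h | h
  · exact absurd h h2
  · exact ⟨_, h⟩
  · refine ⟨3 ^ i * 2, ?_⟩
    rw [pow_mul, h, ← pow_mul]
    calc c ^ (2 * 2) = c ^ 3 * c := by rw [← pow_succ]
      _ = c := by rw [hc3, one_mul]

/-- The combinatorial core. -/
theorem core {A C : Type*} [CommGroup A] [CommGroup C] [Fintype A] [Finite C] [IsCyclic C]
    (hA : Fintype.card A = 3) {S : Finset (Finset (A × C))} (hS : IsSRing S)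
    {c₁ : C} (hc : orderOf c₁ = 3) {T : Finset (A × C)} (hT : T ∈ S)
    (hcT : ((1, c₁) : A × C) ∈ T)
    (hclosed : ∀ x ∈ T, x ^ 3 ≠ 1 → x * (1, c₁) ∈ T)
    {x₀ : A × C} (hx₀ : x₀ ∈ T) (hx₀3 : x₀ ^ 3 ≠ 1) : ((1, c₁) : A × C)⁻¹ ∈ T := by
  by_contra hcon
  set c : A × C := (1, c₁) with hcdef
  have hc3 : c ^ 3 = 1 := by
    ext
    · simp [hcdef]
    · simp only [hcdef, Prod.pow_snd, Prod.snd_one]; rw [← hc]; exact pow_orderOf_eq_one c₁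
  have hc1 : c₁ ≠ 1 := by rintro rfl; simp at hc
  have hcinv : c⁻¹ = c ^ 2 := by
    rw [inv_eq_iff_mul_eq_one, ← pow_succ', hc3]
  have hccc : c * c * c = 1 := by rw [← hc3]; simp [pow_succ]
  have hone : (1 : A × C) ∉ T := by
    intro h
    have := class_eq hS hT hS.one_mem h (by simp)
    rw [this] at hcT
    simp [hcdef] at hcT
    exact hc1 hcT
  have hinv : ∀ x ∈ T, x⁻¹ ∉ T := by
    intro x hx hxi
    exact hcon (inv_class hS hT hx hxi hcT)
  have hA3 : ∀ a : A, a ^ 3 = 1 := fun a => by rw [← hA]; exact pow_card_eq_one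
  -- elements outside `E`
  have hmulc : ∀ x : A × C, x ^ 3 ≠ 1 → (x * c) ^ 3 ≠ 1 := by
    intro x hx; rwa [mul_pow, hc3, mul_one]
  have hcl2 : ∀ x ∈ T, x ^ 3 ≠ 1 → x * c * c ∈ T := fun x hx h3 =>
    hclosed _ (hclosed x hx h3) (hmulc x h3)
  -- elements of `E` with the same first coordinate
  have hE : ∀ u v : A × C, u ^ 3 = 1 → v ^ 3 = 1 → u.1 = v.1 → v = u ∨ v = u * c ∨ v = u * c * c := by
    intro u v hu hv huv
    have h3 : (u.2⁻¹ * v.2) ^ 3 = 1 := by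
      have h1 : u.2 ^ 3 = 1 := by rw [← Prod.pow_snd, hu]; rfl
      have h2 : v.2 ^ 3 = 1 := by rw [← Prod.pow_snd, hv]; rfl
      rw [mul_pow, inv_pow, h1, h2]; simp
    rcases cyc3 hc h3 with h | h | h
    · left; ext
      · exact huv.symm
      · exact (inv_mul_eq_one.mp h).symm
    · right; left; ext
      · simp [hcdef, huv]
      · rw [inv_mul_eq_iff_eq_mul] at h; simpa [hcdef] using h
    · right; right; ext
      · simp [hcdef, huv]
      · rw [inv_mul_eq_iff_eq_mul] at h; simpa [hcdef, pow_two, mul_assoc] using h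
  set B := T.filter (fun t => c⁻¹ * t ∉ T) with hB
  have hcinv' : ∀ t : A × C, c⁻¹ * t = t * c * c := by
    intro t; rw [hcinv, pow_two, mul_comm, mul_assoc]
  have hBE : ∀ t ∈ B, t ^ 3 = 1 := by
    intro t ht
    rw [hB, Finset.mem_filter, hcinv'] at ht
    by_contra h
    exact ht.2 (hcl2 t ht.1 h)
  have hBinj : Set.InjOn Prod.fst (B : Set (A × C)) := by
    intro u hu v hv huv
    have hu' := hBE u hu
    have hv' := hBE v hv
    have hu2 := Finset.mem_filter.mp (Finset.mem_coe.mp hu)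
    have hv2 := Finset.mem_filter.mp (Finset.mem_coe.mp hv)
    rw [hcinv'] at hu2 hv2
    rcases hE u v hu' hv' huv with h | h | h
    · exact h.symm
    · exfalso
      apply hv2.2
      rw [h, mul_assoc, mul_assoc, ← mul_assoc c c c, hccc, mul_one]
      exact hu2.1
    · exact absurd (h ▸ hv2.1) hu2.2
  have hBcard : B.card ≤ 3 := by
    rw [← hA, ← Finset.card_univ]
    exact Finset.card_le_card_of_injOn Prod.fst (by simp) hBinj
  -- the three forced elements
  have hforced : ∀ x ∈ T, x ^ 3 ≠ 1 →
      (({c, x, x * c * c} : Finset (A × C)) ⊆ T.filter (fun t => x⁻¹ * t ∉ T)) ∧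
      ({c, x, x * c * c} : Finset (A × C)).card = 3 := by
    intro x hx hx3
    have hxi3 : (x⁻¹ * c) ^ 3 ≠ 1 := by
      rw [mul_pow, hc3, mul_one, inv_pow]; simpa using hx3
    constructor
    · intro t ht
      simp only [Finset.mem_insert, Finset.mem_singleton] at ht
      rw [Finset.mem_filter]
      rcases ht with rfl | rfl | rfl
      · refine ⟨hcT, fun h => hinv x hx ?_⟩
        have := hcl2 _ h hxi3
        rwa [mul_assoc, mul_assoc, ← mul_assoc c c c, hccc, mul_one] at this
      · refine ⟨hx, ?_⟩
        simpa using hone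
      · refine ⟨hcl2 x hx hx3, ?_⟩
        rw [mul_assoc, inv_mul_cancel_left, ← pow_two, ← hcinv]
        exact hcon
    · have hcx : c ≠ x := fun h => hx3 (h ▸ hc3)
      have hcxc : c ≠ x * c * c := fun h => hmulc _ (hmulc _ hx3) (h ▸ hc3)
      have hxx : x ≠ x * c * c := by
        intro h
        rw [mul_assoc, left_eq_mul, ← pow_two, ← hcinv, inv_eq_one] at h
        exact hc1 (congrArg Prod.snd h)
      rw [Finset.card_insert_of_notMem, Finset.card_insert_of_notMem, Finset.card_singleton]
      · simpa using hxx
      · simp [hcx, hcxc]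
  have hdef : ∀ x ∈ T, (T.filter (fun t => x⁻¹ * t ∉ T)).card = B.card := fun x hx => by
    rw [hB]
    convert deficit_const hS hT hx hcT
  have hB3 : B.card = 3 := by
    obtain ⟨h1, h2⟩ := hforced x₀ hx₀ hx₀3
    have h3 := Finset.card_le_card h1
    rw [hdef x₀ hx₀] at h3
    omega
  have hsurj : ∀ a : A, ∃ u ∈ B, u.1 = a := by
    have h1 : B.image Prod.fst = Finset.univ := by
      apply Finset.eq_univ_of_card
      rw [Finset.card_image_of_injOn hBinj, hB3, hA]
    intro a
    have := Finset.mem_univ a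
    rw [← h1] at this
    simpa only [Finset.mem_image] using this
  have hstep : ∀ x ∈ T, x ^ 3 ≠ 1 → ∀ a : A, a ≠ 1 →
      x⁻¹ * (a, 1) ∈ T ∧ (x⁻¹ * (a, 1)) ^ 3 ≠ 1 := by
    intro x hx hx3 a ha
    have hE3 : ∀ w : A × C, w ^ 3 = 1 → (x⁻¹ * w) ^ 3 ≠ 1 := by
      intro w hw
      rw [mul_pow, hw, mul_one, inv_pow]; simpa using hx3
    have hs3 : ((a, 1) : A × C) ^ 3 = 1 := by
      ext
      · simp [hA3]
      · simp
    refine ⟨?_, hE3 _ hs3⟩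
    obtain ⟨u, hu, hua⟩ := hsurj a
    have hu3 := hBE u hu
    have huT := (Finset.mem_filter.mp hu).1
    have hxu : x⁻¹ * u ∈ T := by
      by_contra hxu
      obtain ⟨h1, h2⟩ := hforced x hx hx3
      have h3 : (T.filter (fun t => x⁻¹ * t ∉ T)).card
          ≤ ({c, x, x * c * c} : Finset (A × C)).card := by
        rw [h2, hdef x hx, hB3]
      have h4 := Finset.eq_of_subset_of_card_le h1 h3
      have h5 : u ∈ ({c, x, x * c * c} : Finset (A × C)) := by
        rw [h4, Finset.mem_filter]; exact ⟨huT, hxu⟩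
      simp only [Finset.mem_insert, Finset.mem_singleton] at h5
      rcases h5 with h | h | h
      · apply ha; rw [← hua, h]
      · exact hx3 (h ▸ hu3)
      · exact hmulc _ (hmulc _ hx3) (h ▸ hu3)
    rcases hE u (a, 1) hu3 hs3 hua with h | h | h
    · rw [h]; exact hxu
    · rw [h, ← mul_assoc]; exact hclosed _ hxu (hE3 u hu3)
    · rw [h, ← mul_assoc, ← mul_assoc]; exact hcl2 _ hxu (hE3 u hu3)
  have : Nontrivial A := Fintype.one_lt_card_iff_nontrivial.mp (by omega)
  obtain ⟨a, ha⟩ := exists_ne (1 : A)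
  have ha2 : a * a ≠ 1 := by
    intro h
    apply ha
    have := hA3 a
    rwa [pow_succ, pow_two, h, one_mul] at this
  obtain ⟨p1, q1⟩ := hstep x₀ hx₀ hx₀3 a ha
  obtain ⟨p2, q2⟩ := hstep _ p1 q1 (a * a) ha2
  obtain ⟨p3, q3⟩ := hstep _ p2 q2 a ha
  apply hinv x₀ hx₀
  convert p3 using 1
  ext
  · simp; rw [eq_comm, mul_assoc, mul_comm, mul_assoc, mul_assoc]; simp
  · simp

end Helpers

/-- if the basic set `T_{c₁}` containing `c₁` (an element of
order 3 of the cyclic factor) is nonregular, then it is rational: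
`T^{(m)} = T` for every integer `m` coprime to 3. -/
theorem stmt9 (n : ℕ) (hn : 2 ≤ n) (S : Finset (Finset (Dgrp n)))
    (hS : IsSRing S) (c₁ : Multiplicative (ZMod (3 ^ n))) (hc₁ : orderOf c₁ = 3)
    (T : Finset (Dgrp n)) (hT : T ∈ S) (hmem : ((1, c₁) : Dgrp n) ∈ T)
    (hnonreg : ∃ a ∈ T, ∃ b ∈ T, orderOf a ≠ orderOf b) :
    ∀ m : ℤ, Int.gcd m 3 = 1 → T.image (· ^ m) = T := by
  intro m hm
  have hcard : Nat.card (Dgrp n) = 3 ^ (n + 1) := by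
    rw [Nat.card_prod]
    simp [pow_succ, mul_comm]
  have hschur : ∀ k : ℕ, k ≠ 0 → k.Coprime 3 → ∀ x ∈ T, x ^ k ∈ T → ∀ y ∈ T, ∃ z ∈ T, z ^ k = y :=
    fun k hk hk3 => schur_mul hS k (by rw [hcard]; exact hk3.pow_right _) hk T hT T hT
  have hc3 : c₁ ^ 3 = 1 := orderOf_dvd_iff_pow_eq_one.mp hc₁.dvd
  have himg : ∀ k : ℕ, k ≠ 0 → k.Coprime 3 → ∀ x ∈ T, x ^ k ∈ T → T.image (· ^ k) = T := by
    intro k hk hk3 x hx hxk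
    symm
    apply Finset.eq_of_subset_of_card_le
    · intro y hy
      obtain ⟨z, hz, h⟩ := hschur k hk hk3 x hx hxk y hy
      exact Finset.mem_image.mpr ⟨z, hz, h⟩
    · exact Finset.card_image_le
  have hclosed : ∀ x ∈ T, x ^ 3 ≠ 1 → x * (1, c₁) ∈ T := by
    intro x hx hx3
    have hx1 : (x ^ 3).1 = 1 := by
      have := pow_card_eq_one (x := x.1)
      simpa using this
    have hx2 : (x ^ 3).2 ≠ 1 := fun h => hx3 (Prod.ext hx1 h)
    obtain ⟨k, hk⟩ := exists_pow_eq (n := n) (by simp) hc₁ hx2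
    have hcop : (3 * k + 1).Coprime 3 := by simp
    have him := himg (3 * k + 1) (by omega) hcop _ hmem (by
      have : ((1, c₁) : Dgrp n) ^ (3 * k + 1) = (1, c₁) := by
        ext
        · simp
        · rw [Prod.pow_snd, pow_succ, pow_mul, hc3, one_pow, one_mul]
      rwa [this])
    have hxe : x * (1, c₁) = x ^ (3 * k + 1) := by
      rw [pow_succ', pow_mul]
      congr 1
      ext
      · rw [Prod.pow_fst, hx1]; simp
      · rw [Prod.pow_snd, hk]
    rw [hxe, ← him]
    exact Finset.mem_image_of_mem _ hx
  have hone : (1 : Dgrp n) ∉ T := by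
    intro h
    have := class_eq hS hT hS.one_mem h (by simp)
    rw [this] at hmem
    have h2 : c₁ = 1 := by simpa [Prod.ext_iff] using hmem
    rw [h2] at hc₁
    simp at hc₁
  have hord : ∀ x ∈ T, x ^ 3 = 1 → orderOf x = 3 := fun x hx h =>
    orderOf_eq_prime h (fun h1 => hone (h1 ▸ hx))
  obtain ⟨x₀, hx₀, hx₀3⟩ : ∃ x ∈ T, x ^ 3 ≠ 1 := by
    by_contra! hcon
    obtain ⟨a, ha, b, hb, hab⟩ := hnonreg
    exact hab ((hord a ha (hcon a ha)).trans (hord b hb (hcon b hb)).symm)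
  have hcinv := core (by simp) hS hc₁ hT hmem hclosed hx₀ hx₀3
  -- reduce to natural exponents
  set N : ℤ := 3 ^ (n + 1) with hN
  have hNpos : 0 < N := by positivity
  have h3N : (3 : ℤ) ∣ N := dvd_pow_self 3 (by omega)
  obtain ⟨k, hk⟩ := Int.eq_ofNat_of_zero_le (Int.emod_nonneg m hNpos.ne')
  have hpow : ∀ x : Dgrp n, x ^ m = x ^ k := by
    intro x
    have hx : x ^ (3 ^ (n + 1)) = 1 := by rw [← hcard]; exact pow_card_eq_one'
    have h1 : x ^ N = 1 := by
      rw [hN, ← hx, ← zpow_natCast]; push_cast; rfl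
    rw [← zpow_natCast, ← hk, ← Int.emod_add_mul_ediv m N, zpow_add, zpow_mul, h1]
    simp
  have hmod : (k : ℤ) % 3 = m % 3 := by
    rw [← hk]; exact Int.emod_emod_of_dvd m h3N
  have hm3 : ¬ (3 : ℤ) ∣ m := by
    intro h
    have := Int.gcd_eq_right_iff_dvd (by norm_num) |>.mpr h
    omega
  have hk12 : k % 3 = 1 ∨ k % 3 = 2 := by omega
  have hkcop : k.Coprime 3 := by
    rw [Nat.coprime_comm, Nat.Prime.coprime_iff_not_dvd Nat.prime_three]; omega
  have hcc3 : ((1, c₁) : Dgrp n) ^ 3 = 1 := by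
    ext
    · simp
    · exact hc3
  have hck : ((1, c₁) : Dgrp n) ^ k ∈ T := by
    rw [pow_eq_pow_mod k hcc3]
    rcases hk12 with h | h
    · rw [h, pow_one]; exact hmem
    · rw [h]
      have : ((1, c₁) : Dgrp n) ^ 2 = (1, c₁)⁻¹ := by
        rw [eq_inv_iff_mul_eq_one, ← pow_succ, hcc3]
      rw [this]; exact hcinv
  have hfun : (fun x : Dgrp n => x ^ m) = (fun x => x ^ k) := funext hpow
  rw [hfun]
  exact himg k (by rintro rfl; simp at hk12) hkcop _ hmem hck
end

section
/- Let D = Z_3 × Z_{3^n} with n ≥ 2 and let A be an S-ring over D such that every basic set of A containing an element of order 3^n (a 'highest' basic set) has trivial radical. If there exists a highest basic set X that is nonregular (contains elements of two distinct orders) and has trivial radical, then A decomposes as a tensor product A = A_H ⊗ A_L where H, L are A-subgroups with D = H × L, rk(A_H) = 2 (i.e., A_H has exactly two basic sets, {e} and H\{e}), and |L| ≤ 3 ≤ |H|. -/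
open scoped BigOperators Pointwise Classical

namespace SR

section General

variable {G : Type*} [CommGroup G] [Fintype G]

lemma ind_apply (X : Finset G) (g : G) : (ind X).coeff g = if g ∈ X then 1 else 0 := by
  unfold ind
  rw [MonoidAlgebra.coeff_sum, Finsupp.finsetSum_apply]
  simp [Finsupp.single_apply]

/-- Combinatorial version of being an `A`-set. -/
def IsU (S : Finset (Finset G)) (T : Finset G) : Prop :=
  ∀ X ∈ S, ∀ g ∈ X, g ∈ T → X ⊆ T

variable {S : Finset (Finset G)} 

lemma eq_of_mem (hS : IsSRing S) {X Y : Finset G} (hX : X ∈ S) (hY : Y ∈ S) {g : G}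
    (h1 : g ∈ X) (h2 : g ∈ Y) : X = Y := by
  by_contra h
  exact Finset.disjoint_left.1 (hS.disj X hX Y hY h) h1 h2

lemma mem_span (hS : IsSRing S) (a : MonoidAlgebra ℤ G) :
    a ∈ spanA S ↔ ∀ X ∈ S, ∀ g ∈ X, ∀ h ∈ X, a.coeff g = a.coeff h := by
  constructor
  · intro ha
    unfold spanA at ha
    induction ha using Submodule.span_induction with
    | mem x hx =>
      obtain ⟨Y, hY, rfl⟩ := hx
      intro X hX g hg h hh
      have hY : Y ∈ S := hY
      rw [ind_apply, ind_apply]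
      by_cases hgY : g ∈ Y
      · have := eq_of_mem hS hX hY hg hgY
        subst this
        simp [hg, hh]
      · by_cases hhY : h ∈ Y
        · have := eq_of_mem hS hX hY hh hhY
          subst this
          exact absurd hg hgY
        · simp [hgY, hhY]
    | zero => intros; rfl
    | add x y _ _ hx hy =>
      intro X hX g hg h hh
      have e1 := hx X hX g hg h hh
      have e2 := hy X hX g hg h hh
      change x.coeff g + y.coeff g = x.coeff h + y.coeff h
      rw [e1, e2]
    | smul c x _ hx =>
      intro X hX g hg h hh
      have e1 := hx X hX g hg h hh
      change c • x.coeff g = c • x.coeff h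
      rw [e1]
  · intro h
    have key : a = ∑ X ∈ S, (if hX : X.Nonempty then a.coeff hX.choose else 0) • ind X := by
      ext g
      obtain ⟨Y, hY, hg⟩ := hS.cover g
      have : (∑ X ∈ S, (if hX : X.Nonempty then a.coeff hX.choose else 0) • ind X).coeff g
          = ∑ X ∈ S, (if hX : X.Nonempty then a.coeff hX.choose else 0) * ((ind X).coeff g) := by
        rw [MonoidAlgebra.coeff_sum, Finsupp.finsetSum_apply]
        rfl
      rw [this, Finset.sum_eq_single Y]
      · have hne : Y.Nonempty := ⟨g, hg⟩
        rw [dif_pos hne, ind_apply, if_pos hg, mul_one]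
        exact h Y hY g hg _ hne.choose_spec
      · intro X hX hXY
        rw [ind_apply, if_neg, mul_zero]
        intro hgX
        exact hXY (eq_of_mem hS hX hY hgX hg)
      · intro h'; exact absurd hY h'
    rw [key]
    refine Submodule.sum_mem _ (fun X hX => Submodule.smul_mem _ _ (Submodule.subset_span ⟨X, hX, rfl⟩))

lemma isU_iff (hS : IsSRing S) (T : Finset G) : IsASet S T ↔ IsU S T := by
  unfold IsASet IsU
  rw [mem_span hS]
  constructor
  · intro h X hX g hg hgT x hx
    have := h X hX g hg x hx
    rw [ind_apply, ind_apply, if_pos hgT] at this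
    by_contra hxT
    rw [if_neg hxT] at this
    exact one_ne_zero this
  · intro h X hX g hg x hx
    rw [ind_apply, ind_apply]
    by_cases h1 : g ∈ T
    · rw [if_pos h1, if_pos (h X hX g hg h1 hx)]
    · rw [if_neg h1, if_neg (fun h2 => h1 (h X hX x hx h2 hg))]

lemma isU_of_mem (hS : IsSRing S) {X : Finset G} (hX : X ∈ S) : IsU S X := by
  intro Y hY g hg hgX
  rw [eq_of_mem hS hX hY hgX hg]

lemma ind_mul_apply (X Y : Finset G) (g : G) :
    (ind X * ind Y).coeff g = ((X.filter (fun x => x⁻¹ * g ∈ Y)).card : ℤ) := by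
  have : ind X * ind Y = ∑ x ∈ X, ∑ y ∈ Y, MonoidAlgebra.single (x * y) (1 : ℤ) := by
    unfold ind
    rw [Finset.sum_mul_sum]
    simp [MonoidAlgebra.single_mul_single]
  rw [this, MonoidAlgebra.coeff_sum, Finsupp.finsetSum_apply, Finset.card_filter, Nat.cast_sum]
  refine Finset.sum_congr rfl (fun x _ => ?_)
  rw [MonoidAlgebra.coeff_sum, Finsupp.finsetSum_apply]
  have : ∀ y ∈ Y, (MonoidAlgebra.single (x * y) (1 : ℤ)).coeff g = if y = x⁻¹ * g then 1 else 0 := by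
    intro y _
    simp only [MonoidAlgebra.coeff_single, Finsupp.single_apply]
    congr 1
    simp only [eq_iff_iff]
    constructor
    · rintro rfl; simp
    · rintro rfl; simp
  rw [Finset.sum_congr rfl this]
  simp

lemma count_eq (hS : IsSRing S) {X Y Z : Finset G} (hX : IsU S X) (hY : IsU S Y) (hZ : Z ∈ S)
    {g h : G} (hg : g ∈ Z) (hh : h ∈ Z) :
    (X.filter (fun x => x⁻¹ * g ∈ Y)).card = (X.filter (fun x => x⁻¹ * h ∈ Y)).card := by
  have h1 := hS.mul_closed _ ((isU_iff hS X).2 hX) _ ((isU_iff hS Y).2 hY)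
  have h2 := (mem_span hS _).1 h1 Z hZ g hg h hh
  rw [ind_mul_apply, ind_mul_apply] at h2
  exact_mod_cast h2

lemma inv_mem_of (hS : IsSRing S) {X Y : Finset G} (hX : X ∈ S) (hY : Y ∈ S) {g : G}
    (h1 : g ∈ X) (h2 : g⁻¹ ∈ Y) : ∀ x, x ∈ X ↔ x⁻¹ ∈ Y := by
  have h3 := hS.inv_mem X hX
  have h4 : g⁻¹ ∈ X.image (·⁻¹) := Finset.mem_image_of_mem _ h1
  have h5 := eq_of_mem hS h3 hY h4 h2
  intro x
  rw [← h5]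
  exact ⟨fun h => Finset.mem_image_of_mem _ h, fun h => by
    obtain ⟨a, ha, hax⟩ := Finset.mem_image.1 h
    have : a = x := inv_injective hax
    exact this ▸ ha⟩

lemma isU_inv (hS : IsSRing S) {X : Finset G} (hX : IsU S X) : IsU S (X.image (·⁻¹)) := by
  intro Y hY g hg hgX
  have hg' : g⁻¹ ∈ X := by
    obtain ⟨a, ha, rfl⟩ := Finset.mem_image.1 hgX
    simpa using ha
  obtain ⟨Z, hZ, hgZ⟩ := hS.cover g⁻¹
  have h1 := hX Z hZ _ hgZ hg'
  intro y hy
  have h2 := (inv_mem_of hS hY hZ hg hgZ y).1 hy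
  exact Finset.mem_image.2 ⟨y⁻¹, h1 h2, inv_inv y⟩

/-- Autocorrelation. -/
noncomputable def lam (X : Finset G) (g : G) : ℕ := (X.filter (fun x => g⁻¹ * x ∈ X)).card

lemma lam_eq (hS : IsSRing S) {X Z : Finset G} (hX : IsU S X) (hZ : Z ∈ S)
    {g h : G} (hg : g ∈ Z) (hh : h ∈ Z) : lam X g = lam X h := by
  have := count_eq hS hX (isU_inv hS hX) hZ hg hh
  have e : ∀ g : G, X.filter (fun x => g⁻¹ * x ∈ X) = X.filter (fun x => x⁻¹ * g ∈ X.image (·⁻¹)) := by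
    intro g
    refine Finset.filter_congr (fun x _ => ⟨fun h => ?_, fun h => ?_⟩)
    · exact Finset.mem_image.2 ⟨_, h, by simp⟩
    · obtain ⟨a, ha, hax⟩ := Finset.mem_image.1 h
      have : a = g⁻¹ * x := by
        have := congrArg (·⁻¹) hax
        simpa using this
      exact this ▸ ha
  unfold lam
  rw [e g, e h]
  exact this

lemma lam_inv (X : Finset G) (g : G) : lam X g⁻¹ = lam X g := by
  unfold lam
  refine Finset.card_bij (fun x _ => g * x) ?_ ?_ ?_
  · intro x hx; simp at hx ⊢; exact ⟨hx.2, hx.1⟩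
  · intro a _ b _ h; exact mul_left_cancel h
  · intro b hb; simp only [Finset.mem_filter] at hb
    exact ⟨g⁻¹ * b, by simp [hb.1, hb.2], by simp⟩

/-- Intersection with a coset. -/
noncomputable def cos (X : Finset G) (K : Subgroup G) (g : G) : Finset G := X.filter (fun x => x⁻¹ * g ∈ K)

lemma cos_card (hS : IsSRing S) {X : Finset G} {K : Subgroup G} (hX : X ∈ S)
    (hK : IsU S (subgroupFinset K)) {g h : G} (hg : g ∈ X) (hh : h ∈ X) :
    (cos X K g).card = (cos X K h).card := by
  have := count_eq hS (isU_of_mem hS hX) hK hX hg hh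
  simpa [cos, subgroupFinset] using this

lemma sum_lam (X T : Finset G) : 
    ∑ g ∈ T, lam X g = ∑ x ∈ X, (X.filter (fun a => x * a⁻¹ ∈ T)).card := by
  unfold lam
  simp only [Finset.card_filter]
  rw [Finset.sum_comm]
  refine Finset.sum_congr rfl (fun x hx => ?_)
  rw [← Finset.card_filter, ← Finset.card_filter]
  refine Finset.card_bij (fun g _ => g⁻¹ * x) ?_ ?_ ?_
  · intro g hg; simp at hg ⊢; exact ⟨hg.2, hg.1⟩
  · intro a _ b _ h; simpa using h
  · intro a ha; simp at ha; exact ⟨x * a⁻¹, by simp [ha], by simp⟩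

lemma sum_lam_sub (hS : IsSRing S) {X : Finset G} {K : Subgroup G} (hX : X ∈ S)
    (hK : IsU S (subgroupFinset K)) {y : G} (hy : y ∈ X) :
    ∑ g ∈ subgroupFinset K, lam X g = X.card * (cos X K y).card := by
  rw [sum_lam, Finset.sum_const_nat]
  intro x hx
  rw [← cos_card hS hX hK hx hy]
  simp [cos, subgroupFinset, mul_comm]

lemma sum_lam_univ (X : Finset G) : ∑ g : G, lam X g = X.card * X.card := by
  rw [sum_lam, Finset.sum_const_nat]
  intro x hx
  simp

lemma lam_one (X : Finset G) : lam X 1 = X.card := by simp [lam]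

lemma isU_closure (hS : IsSRing S) {X : Finset G} (hX : IsU S X) :
    IsU S (subgroupFinset (Subgroup.closure (X : Set G))) := by
  have key : ∀ g ∈ Subgroup.closure (X : Set G), ∀ Y ∈ S, g ∈ Y →
      ∀ y ∈ Y, y ∈ Subgroup.closure (X : Set G) := by
    intro g hg
    induction hg using Subgroup.closure_induction with
    | mem x hx =>
      intro Y hY hxY y hy
      exact Subgroup.subset_closure (hX Y hY x hxY hx hy)
    | one =>
      intro Y hY h1 y hy
      have := eq_of_mem hS hY hS.one_mem h1 (by simp)
      subst this
      simp at hy; subst hy; exact one_mem _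
    | mul a b _ _ ha hb =>
      intro Y hY hab y hy
      obtain ⟨A, hA, haA⟩ := hS.cover a
      obtain ⟨B, hB, hbB⟩ := hS.cover b
      have h1 := count_eq hS (isU_of_mem hS hA) (isU_of_mem hS hB) hY hab hy
      have h2 : 0 < (A.filter (fun x => x⁻¹ * (a * b) ∈ B)).card :=
        Finset.card_pos.2 ⟨a, by simp [haA, hbB]⟩
      rw [h1] at h2
      obtain ⟨x, hx⟩ := Finset.card_pos.1 h2
      simp at hx
      have := mul_mem (ha A hA haA x hx.1) (hb B hB hbB _ hx.2)
      simpa using this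
    | inv a _ ha =>
      intro Y hY haY y hy
      obtain ⟨A, hA, haA⟩ := hS.cover a
      have := (inv_mem_of hS hA hY haA haY y⁻¹).2 (by simpa using hy)
      simpa using ha A hA haA _ this
  intro Y hY g hg hgK y hy
  simp [subgroupFinset] at hgK ⊢
  exact key g hgK Y hY hg y hy

lemma mul_isU (hS : IsSRing S) {X Y Z : Finset G} (hX : IsU S X) (hY : IsU S Y) (hZ : Z ∈ S)
    {a b g : G} (ha : a ∈ X) (hb : b ∈ Y) (hab : a * b ∈ Z) (hg : g ∈ Z) :
    ∃ a' ∈ X, ∃ b' ∈ Y, g = a' * b' := by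
  have h1 := count_eq hS hX hY hZ hab hg
  have h2 : 0 < (X.filter (fun x => x⁻¹ * (a * b) ∈ Y)).card :=
    Finset.card_pos.2 ⟨a, by simp [ha, hb]⟩
  rw [h1] at h2
  obtain ⟨x, hx⟩ := Finset.card_pos.1 h2
  simp at hx
  exact ⟨x, hx.1, _, hx.2, by simp⟩

/-! Multipliers. -/

lemma ind_pow_mod (X : Finset G) (p : ℕ) [Fact p.Prime] (g : G) :
    (((ind X) ^ p).coeff g : ZMod p) = ((X.filter (fun x => x ^ p = g)).card : ZMod p) := by
  let φ := MonoidAlgebra.mapRingHom G (Int.castRingHom (ZMod p))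
  have h1 : (φ (ind X ^ p)).coeff g = (((ind X) ^ p).coeff g : ZMod p) := by
    show (MonoidAlgebra.mapRingHom G (Int.castRingHom (ZMod p)) (ind X ^ p)).coeff g = _
    rw [MonoidAlgebra.coeff_mapRingHom]
    simp
  have h2 : φ (ind X) = ∑ x ∈ X, MonoidAlgebra.single x (1 : ZMod p) := by
    unfold ind
    rw [map_sum]
    simp [φ]
  haveI : CharP (MonoidAlgebra (ZMod p) G) p := by
    exact charP_of_injective_algebraMap' (ZMod p) p
  rw [← h1, map_pow, h2, sum_pow_char]
  simp only [MonoidAlgebra.single_pow, one_pow]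
  rw [MonoidAlgebra.coeff_sum, Finsupp.finsetSum_apply, Finset.card_filter, Nat.cast_sum]
  refine Finset.sum_congr rfl (fun x _ => ?_)
  simp [Finsupp.single_apply]

lemma pow_inj_of_coprime {m : ℕ} (hm : (Fintype.card G).Coprime m) :
    Function.Injective (fun x : G => x ^ m) := by
  have := (powCoprime (G := G) (n := m) (by rwa [Nat.card_eq_fintype_card])).injective
  exact this

lemma isU_pow_prime (hS : IsSRing S) {X : Finset G} (hX : IsU S X) {p : ℕ} (hp : p.Prime)
    (hc : (Fintype.card G).Coprime p) : IsU S (X.image (· ^ p)) := by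
  haveI : Fact p.Prime := ⟨hp⟩
  have hone : (1 : MonoidAlgebra ℤ G) ∈ spanA S := by
    have : (1 : MonoidAlgebra ℤ G) = ind {1} := by simp [ind, MonoidAlgebra.one_def]
    rw [this]
    exact Submodule.subset_span ⟨_, hS.one_mem, rfl⟩
  have hpow : ∀ k : ℕ, (ind X) ^ k ∈ spanA S := by
    intro k
    induction k with
    | zero => simpa using hone
    | succ k ih => rw [pow_succ]; exact hS.mul_closed _ ih _ ((isU_iff hS X).2 hX)
  have inj := pow_inj_of_coprime hc
  have hval : ∀ g : G, (((ind X) ^ p).coeff g : ZMod p) = if g ∈ X.image (· ^ p) then 1 else 0 := by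
    intro g
    rw [ind_pow_mod]
    split_ifs with h
    · obtain ⟨x, hx, rfl⟩ := Finset.mem_image.1 h
      have : X.filter (fun y => y ^ p = x ^ p) = {x} := by
        ext y; simp only [Finset.mem_filter, Finset.mem_singleton]
        constructor
        · rintro ⟨_, h⟩; exact inj h
        · rintro rfl; exact ⟨hx, rfl⟩
      simp only [this]; simp
    · have : X.filter (fun y => y ^ p = g) = ∅ := by
        ext y; simp only [Finset.mem_filter, Finset.notMem_empty, iff_false]
        rintro ⟨hy, rfl⟩
        exact h (Finset.mem_image_of_mem _ hy)
      rw [this]; simp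
  intro Y hY g hg hgX y hy
  have h1 := (mem_span hS _).1 (hpow p) Y hY g hg y hy
  have h2 := hval g
  have h3 := hval y
  rw [← h1, h2, if_pos hgX] at h3
  by_contra h
  rw [if_neg h] at h3
  exact one_ne_zero h3

lemma isU_pow (hS : IsSRing S) (m : ℕ) (hm0 : m ≠ 0) (hc : (Fintype.card G).Coprime m) :
    ∀ {X : Finset G}, IsU S X → IsU S (X.image (· ^ m)) := by
  induction m using Nat.recOnMul with
  | zero => exact absurd rfl hm0
  | one => intro X hX; simpa using hX
  | prime p hp => intro X hX; exact isU_pow_prime hS hX hp hc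
  | mul a b iha ihb =>
    intro X hX
    have h1 := iha (by rintro rfl; simp at hm0) (Nat.Coprime.coprime_mul_right_right hc) hX
    have h2 := ihb (by rintro rfl; simp at hm0) (Nat.Coprime.coprime_mul_left_right hc) h1
    rw [Finset.image_image] at h2
    convert h2 using 2
    ext x
    simp [pow_mul]

lemma pow_mem_basic (hS : IsSRing S) {m : ℕ} (hm0 : m ≠ 0) (hc : (Fintype.card G).Coprime m)
    {X Y : Finset G} (hX : X ∈ S) (hY : Y ∈ S) {x : G} (hx : x ∈ X) (hxm : x ^ m ∈ Y) :
    ∀ y ∈ X, y ^ m ∈ Y := by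
  have h1 := isU_pow hS m hm0 hc (isU_of_mem hS hY)
  -- use inverse exponent
  obtain ⟨k, hk⟩ : ∃ k : ℕ, ∀ g : G, g ^ (m ^ (k + 1)) = g := by
    refine ⟨(Fintype.card G).totient - 1, fun g => ?_⟩
    have hpos : 0 < (Fintype.card G).totient := Nat.totient_pos.2 Fintype.card_pos
    rw [Nat.sub_add_cancel hpos]
    have h2 := Nat.ModEq.pow_totient hc.symm
    have h3 : m ^ (Fintype.card G).totient ≡ 1 [MOD orderOf g] :=
      h2.of_dvd (orderOf_dvd_card)
    have := (pow_eq_pow_iff_modEq (x := g)).2 h3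
    simpa using this
  have hc2 : (Fintype.card G).Coprime (m ^ k) := Nat.Coprime.pow_right k hc
  have h2 := isU_pow hS (m ^ k) (pow_ne_zero _ hm0) hc2 (isU_of_mem hS hY)
  have h3 : x ∈ Y.image (· ^ (m ^ k)) := by
    refine Finset.mem_image.2 ⟨_, hxm, ?_⟩
    change (x ^ m) ^ (m ^ k) = x
    rw [← pow_mul, ← pow_succ']
    exact hk x
  intro y hy
  have h4 := h2 X hX x hx h3 hy
  obtain ⟨w, hw, hwy⟩ := Finset.mem_image.1 h4
  have : y ^ m = w := by
    rw [← hwy]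
    change (w ^ (m ^ k)) ^ m = w
    rw [← pow_mul, ← pow_succ]
    exact hk w
  rw [this]; exact hw

end General

end SR

namespace SR

/-- The facts about the group `ℤ₃ × ℤ_{3^n}` that are used below. -/
structure DCtx (G : Type*) [CommGroup G] [Fintype G] (n : ℕ) (z u : G) : Prop where
  z3 : z ^ 3 = 1
  z1 : z ≠ 1
  u3 : u ^ 3 = 1
  uz : u ∉ Subgroup.zpowers z
  ecov : ∀ g : G, g ^ 3 = 1 → ∃ i : ℕ, i < 3 ∧ u ^ i * g ∈ Subgroup.zpowers z
  pown : ∀ g : G, g ^ 3 ^ n = 1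
  cyc : ∀ k (x g : G), x ^ 3 ^ (k + 1) = 1 → g ^ 3 ^ k ≠ 1 → x ^ 3 ∈ Subgroup.zpowers (g ^ 3)
  cube : ∀ g : G, g ^ 3 ≠ 1 → z ∈ Subgroup.zpowers (g ^ 3)
  card : Fintype.card G = 3 ^ (n + 1)
  npos : 2 ≤ n
  high : ∃ c : G, c ^ 3 ^ (n - 1) ≠ 1

lemma solve_lin (n k j j' : ℕ) (h1 : ¬ 3 ^ n ∣ j * 3 ^ k) (h2 : 3 ^ n ∣ j' * 3 ^ (k + 1)) :
    ∃ x y : ℤ, (j' : ℤ) = j * x + (3 ^ n : ℕ) * y := by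
  obtain ⟨a, ha, hg⟩ := (Nat.dvd_prime_pow Nat.prime_three).1 (Nat.gcd_dvd_right j (3 ^ n))
  have hk : a + k + 1 ≤ n := by
    by_contra hcon
    apply h1
    have : 3 ^ a ∣ j := hg ▸ Nat.gcd_dvd_left j (3 ^ n)
    calc 3 ^ n ∣ 3 ^ (a + k) := pow_dvd_pow _ (by omega)
      _ = 3 ^ a * 3 ^ k := pow_add _ _ _
      _ ∣ j * 3 ^ k := Nat.mul_dvd_mul_right this _
  have h3 : 3 ^ a * 3 ^ (k + 1) ∣ j' * 3 ^ (k + 1) := by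
    rw [← pow_add]
    exact (pow_dvd_pow _ (by omega)).trans h2
  have h4 : 3 ^ a ∣ j' := Nat.dvd_of_mul_dvd_mul_right (by positivity) h3
  rw [← hg] at h4
  have := (Int.gcd_dvd_iff (a := j) (b := ((3 ^ n : ℕ) : ℤ)) (n := j')).1 (by rw [Int.gcd_natCast_natCast]; exact h4)
  exact this

/-- Build the context from a pair of generators. -/
lemma DCtx.of_gen {G : Type*} [CommGroup G] [Fintype G] (n : ℕ) (hn : 2 ≤ n) (u c : G)
    (hu : u ^ 3 = 1) (hc : c ^ 3 ^ n = 1)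
    (hind : ∀ i j : ℕ, u ^ i * c ^ j = 1 → 3 ∣ i ∧ 3 ^ n ∣ j)
    (hgen : ∀ g : G, ∃ i j : ℕ, g = u ^ i * c ^ j)
    (hcard : Fintype.card G = 3 ^ (n + 1)) : DCtx G n (c ^ 3 ^ (n - 1)) u := by
  have hcj : ∀ j : ℕ, c ^ j = 1 ↔ 3 ^ n ∣ j := fun j =>
    ⟨fun h => (hind 0 j (by simpa using h)).2, fun ⟨t, ht⟩ => by rw [ht, pow_mul, hc, one_pow]⟩
  have hu' : ∀ k, u ^ 3 ^ (k + 1) = 1 := fun k => by rw [pow_succ', pow_mul, hu, one_pow]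
  have hpow : ∀ i j k : ℕ, (u ^ i * c ^ j) ^ 3 ^ (k + 1) = c ^ (j * 3 ^ (k + 1)) := by
    intro i j k
    rw [mul_pow, ← pow_mul, mul_comm i, pow_mul, hu', one_pow, one_mul, ← pow_mul]
  have hpow3 : ∀ i j : ℕ, (u ^ i * c ^ j) ^ 3 = c ^ (j * 3) := fun i j => by
    simpa using hpow i j 0
  have hn3 : 3 ^ n = 3 ^ (n - 1) * 3 := by rw [← pow_succ]; congr 1; omega
  have hlin : ∀ (j j' : ℕ), (∃ x y : ℤ, (j' : ℤ) = j * x + (3 ^ n : ℕ) * y) →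
      c ^ j' ∈ Subgroup.zpowers (c ^ j) := by
    rintro j j' ⟨x, y, h⟩
    refine ⟨x, ?_⟩
    change (c ^ j) ^ x = _
    rw [← zpow_natCast c j', h, zpow_add, zpow_mul, zpow_mul, zpow_natCast, zpow_natCast, hc,
      one_zpow, mul_one]
  refine ⟨?_, ?_, hu, ?_, ?_, ?_, ?_, ?_, hcard, hn, c, ?_⟩
  · rw [← pow_mul, ← hn3, hc]
  · rw [Ne, hcj]
    intro h
    exact absurd (Nat.le_of_dvd (by positivity) h) (by rw [hn3]; have : 0 < 3 ^ (n-1) := by positivity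
                                                       omega)
  · intro h
    obtain ⟨t, ht⟩ := (mem_powers_iff_mem_zpowers.2 h)
    change (c ^ 3 ^ (n - 1)) ^ t = u at ht
    have := (hind 2 (3 ^ (n - 1) * t) (by rw [pow_mul, ht, ← pow_succ, hu])).1
    omega
  · intro g hg
    obtain ⟨i, j, rfl⟩ := hgen g
    rw [hpow3, hcj, hn3] at hg
    obtain ⟨q, rfl⟩ := Nat.dvd_of_mul_dvd_mul_right (by norm_num) hg
    refine ⟨(3 - i % 3) % 3, Nat.mod_lt _ (by norm_num), ?_⟩
    have : u ^ ((3 - i % 3) % 3) * u ^ i = 1 := by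
      rw [← pow_add]
      have : 3 ∣ (3 - i % 3) % 3 + i := by omega
      obtain ⟨t, ht⟩ := this
      rw [ht, pow_mul, hu, one_pow]
    rw [← mul_assoc, this, one_mul, pow_mul]
    exact Subgroup.pow_mem _ (Subgroup.mem_zpowers _) _
  · intro g
    obtain ⟨i, j, rfl⟩ := hgen g
    have := hpow i j (n - 1)
    rw [Nat.sub_add_cancel (by omega)] at this
    rw [this, mul_comm, pow_mul, hc, one_pow]
  · intro k x g hx hg
    obtain ⟨i, j, rfl⟩ := hgen g
    obtain ⟨i', j', rfl⟩ := hgen x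
    rcases k with _ | k
    · have : (u ^ i' * c ^ j') ^ 3 = 1 := by simpa using hx
      rw [this]; exact one_mem _
    · rw [hpow, Ne, hcj] at hg
      rw [hpow, hcj] at hx
      obtain ⟨x, y, h⟩ := solve_lin n (k + 1) j j' hg hx
      rw [hpow3, hpow3]
      refine hlin _ _ ⟨x, 3 * y, ?_⟩
      push_cast at h ⊢
      rw [h]; ring
  · intro g hg
    obtain ⟨i, j, rfl⟩ := hgen g
    rw [hpow3] at hg ⊢
    rw [Ne, hcj] at hg
    refine hlin _ _ (solve_lin n 0 (j * 3) _ (by simpa using hg) ?_)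
    rw [hn3]; simp
  · rw [Ne, hcj]
    intro h
    exact absurd (Nat.le_of_dvd (by positivity) h) (by rw [hn3]; have : 0 < 3 ^ (n-1) := by positivity
                                                       omega)

lemma dctx_Dgrp (n : ℕ) (hn : 2 ≤ n) : ∃ z u : Dgrp n, DCtx (Dgrp n) n z u := by
  refine ⟨_, _, DCtx.of_gen n hn (Multiplicative.ofAdd 1, 1) (1, Multiplicative.ofAdd 1) ?_ ?_ ?_ ?_ ?_⟩
  · ext
    · simp only [Prod.pow_fst, Prod.fst_one]
      decide
    · simp
  · ext
    · simp
    · simp only [Prod.pow_snd, Prod.snd_one]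
      rw [← ofAdd_nsmul]
      have : (3 ^ n : ℕ) • (1 : ZMod (3 ^ n)) = 0 := by
        rw [nsmul_eq_mul, mul_one]; exact ZMod.natCast_self _
      rw [this]; rfl
  · intro i j h
    have h1 := congrArg Prod.fst h
    have h2 := congrArg Prod.snd h
    simp only [Prod.fst_mul, Prod.snd_mul, Prod.pow_fst, Prod.pow_snd, one_pow, mul_one, one_mul, Prod.fst_one, Prod.snd_one] at h1 h2
    rw [← ofAdd_nsmul, nsmul_eq_mul, mul_one] at h1 h2
    constructor
    · exact (ZMod.natCast_eq_zero_iff _ _).1 (ofAdd_eq_one.1 h1)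
    · exact (ZMod.natCast_eq_zero_iff _ _).1 (ofAdd_eq_one.1 h2)
  · rintro ⟨a, b⟩
    refine ⟨(Multiplicative.toAdd a).val, (Multiplicative.toAdd b).val, ?_⟩
    ext
    · simp only [Prod.fst_mul, Prod.pow_fst, one_pow, mul_one]
      rw [← ofAdd_nsmul, nsmul_eq_mul, mul_one, ZMod.natCast_val, ZMod.cast_id]; rfl
    · simp only [Prod.snd_mul, Prod.pow_snd, one_pow, one_mul]
      rw [← ofAdd_nsmul, nsmul_eq_mul, mul_one, ZMod.natCast_val, ZMod.cast_id]; rfl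
  · rw [Fintype.card_prod]
    simp [ZMod.card]
    ring

section Ctx

variable {G : Type*} [CommGroup G] [Fintype G] {S : Finset (Finset G)} {n : ℕ} {z u : G}

lemma DCtx.coprime (D : DCtx G n z u) {m : ℕ} (hm : ¬ 3 ∣ m) : (Fintype.card G).Coprime m := by
  rw [D.card]
  exact Nat.Coprime.pow_left _ ((Nat.Prime.coprime_iff_not_dvd Nat.prime_three).2 hm)

lemma DCtx.zmem (D : DCtx G n z u) {k : ℕ} (hk : 1 ≤ k) {y : G} (hy : y ^ 3 ^ k ≠ 1) :
    z ∈ Subgroup.zpowers (y ^ 3 ^ k) := by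
  obtain ⟨k, rfl⟩ : ∃ l, k = l + 1 := ⟨k - 1, by omega⟩
  rw [pow_succ, pow_mul] at hy ⊢
  exact D.cube _ hy

lemma mult_mem (hS : IsSRing S) (D : DCtx G n z u) {X : Finset G} (hX : X ∈ S) {k : ℕ}
    (hk : 1 ≤ k) {x y h : G} (hx : x ∈ X) (hx1 : x ^ 3 ^ k = 1) (hy : y ∈ X)
    (hh : h ∈ Subgroup.zpowers (y ^ 3 ^ k)) : y * h ∈ X := by
  obtain ⟨t, ht⟩ := mem_powers_iff_mem_zpowers.2 hh
  change (y ^ 3 ^ k) ^ t = h at ht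
  have h3 : 3 ∣ 3 ^ k * t := Dvd.dvd.mul_right (dvd_pow_self _ (by omega)) _
  have := pow_mem_basic hS (m := 1 + 3 ^ k * t) (by omega) (D.coprime (by omega)) hX hX hx
    (by rw [pow_add, pow_one, pow_mul, hx1, one_pow, mul_one]; exact hx) y hy
  rwa [pow_add, pow_one, pow_mul, ht] at this

lemma zinv (hS : IsSRing S) (D : DCtx G n z u) {X : Finset G} (hX : X ∈ S) {k : ℕ}
    (hk : 1 ≤ k) {x y : G} (hx : x ∈ X) (hx1 : x ^ 3 ^ k = 1) (hy : y ∈ X)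
    (hy1 : y ^ 3 ^ k ≠ 1) : ∀ h ∈ Subgroup.zpowers z, y * h ∈ X := by
  intro h hh
  refine mult_mem hS D hX hk hx hx1 hy ?_
  have := D.zmem hk hy1
  exact (Subgroup.zpowers_le.2 this) hh

end Ctx

end SR

namespace SR

section Ctx

variable {G : Type*} [CommGroup G] [Fintype G] {S : Finset (Finset G)} {n : ℕ} {z u : G}

lemma DCtx.memC (D : DCtx G n z u) (g : G) :
    g ∈ Subgroup.zpowers z ↔ g = 1 ∨ g = z ∨ g = z ^ 2 := by
  constructor
  · intro h
    obtain ⟨t, ht⟩ := mem_powers_iff_mem_zpowers.2 h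
    change z ^ t = g at ht
    have h3 : z ^ t = z ^ (t % 3) := by
      conv_lhs => rw [← Nat.div_add_mod t 3, pow_add, pow_mul, D.z3, one_pow, one_mul]
    have : t % 3 < 3 := Nat.mod_lt _ (by norm_num)
    rw [← ht, h3]
    interval_cases t % 3 <;> simp
  · rintro (rfl | rfl | rfl)
    · exact one_mem _
    · exact Subgroup.mem_zpowers _
    · exact Subgroup.pow_mem _ (Subgroup.mem_zpowers _) _

lemma DCtx.zinv2 (D : DCtx G n z u) : z⁻¹ = z ^ 2 := by
  rw [inv_eq_iff_mul_eq_one, ← pow_succ', D.z3]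

lemma DCtx.z2 (D : DCtx G n z u) : z ^ 2 ≠ 1 := by
  rw [← D.zinv2]; simpa using D.z1

lemma DCtx.zz2 (D : DCtx G n z u) : z ≠ z ^ 2 := by
  intro h
  apply D.z1
  have : z * 1 = z * z := by rw [mul_one, ← pow_two]; exact h
  exact (mul_left_cancel this).symm

lemma DCtx.C3 (D : DCtx G n z u) {c : G} (hc : c ∈ Subgroup.zpowers z) : c ^ 3 = 1 := by
  obtain ⟨t, rfl⟩ := mem_powers_iff_mem_zpowers.2 hc
  change (z ^ t) ^ 3 = 1
  rw [← pow_mul, mul_comm, pow_mul, D.z3, one_pow]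

lemma DCtx.ecov' (D : DCtx G n z u) {v g : G} (hv3 : v ^ 3 = 1) (hv : v ∉ Subgroup.zpowers z)
    (hg : g ^ 3 = 1) : g ∈ Subgroup.zpowers z ∨ v * g ∈ Subgroup.zpowers z ∨
      v⁻¹ * g ∈ Subgroup.zpowers z := by
  obtain ⟨a, ha, hav⟩ := D.ecov v hv3
  obtain ⟨b, hb, hbg⟩ := D.ecov g hg
  have ha0 : a ≠ 0 := by rintro rfl; simp at hav; exact hv hav
  by_cases hb0 : b = 0
  · subst hb0; left; simpa using hbg
  right
  by_cases hab : a = b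
  · subst hab
    right
    have := mul_mem (inv_mem hav) hbg
    convert this using 1
    rw [mul_inv, mul_comm (u ^ a)⁻¹, mul_assoc, inv_mul_cancel_left]
  · left
    have := mul_mem hav hbg
    have h3 : u ^ a * v * (u ^ b * g) = v * g := by
      rw [mul_mul_mul_comm, ← pow_add, show a + b = 3 by omega, D.u3, one_mul]
    rwa [h3] at this

/-- Elements of `X` outside `gX`. -/
noncomputable def dif (X : Finset G) (g : G) : Finset G := X.filter (fun x => g⁻¹ * x ∉ X)

lemma mem_dif {X : Finset G} {g x : G} : x ∈ dif X g ↔ x ∈ X ∧ g⁻¹ * x ∉ X := by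
  simp [dif]

lemma dif_add (X : Finset G) (g : G) : lam X g + (dif X g).card = X.card := by
  unfold lam dif
  exact Finset.card_filter_add_card_filter_not _

lemma dif_z_unique (D : DCtx G n z u) {X : Finset G} {x c : G} (hx : x ∈ dif X z)
    (hc : c ∈ Subgroup.zpowers z) (hxc : x * c ∈ dif X z) : c = 1 := by
  rw [mem_dif] at hx hxc
  rcases (D.memC c).1 hc with h | rfl | rfl
  · exact h
  · exfalso; apply hxc.2
    rw [mul_comm x, inv_mul_cancel_left]; exact hx.1
  · exfalso; apply hx.2
    rw [D.zinv2, mul_comm]; exact hxc.1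

lemma dif_z_card (D : DCtx G n z u) {X : Finset G} (hE : ∀ x ∈ dif X z, x ^ 3 = 1) :
    (dif X z).card ≤ 3 := by
  have : ∀ x : G, ∃ i : ℕ, i < 3 ∧ (x ^ 3 = 1 → u ^ i * x ∈ Subgroup.zpowers z) := by
    intro x
    by_cases h : x ^ 3 = 1
    · obtain ⟨i, hi, h'⟩ := D.ecov x h
      exact ⟨i, hi, fun _ => h'⟩
    · exact ⟨0, by norm_num, fun h' => absurd h' h⟩
  choose f hf1 hf2 using this
  have h1 : (dif X z).card ≤ (Finset.range 3).card := by
    refine Finset.card_le_card_of_injOn f (fun x _ => by simpa using hf1 x) ?_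
    intro x hx y hy hxy
    have e1 := hf2 x (hE x hx)
    have e2 := hf2 y (hE y hy)
    rw [← hxy] at e2
    have e3 := mul_mem (inv_mem e1) e2
    have e4 : (u ^ f x * x)⁻¹ * (u ^ f x * y) = x⁻¹ * y := by
      rw [mul_inv, mul_comm (u ^ f x)⁻¹, mul_assoc, inv_mul_cancel_left]
    rw [e4] at e3
    have hy' : y ∈ dif X z := hy
    have := dif_z_unique D hx e3 (by simpa using hy')
    exact (inv_mul_eq_one.1 this)
  simpa using h1

lemma four_contra {T : Finset G} (h : T.card ≤ 3) {a b c d : G} (ha : a ∈ T) (hb : b ∈ T)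
    (hc : c ∈ T) (hd : d ∈ T) (hab : a ≠ b) (hac : a ≠ c) (had : a ≠ d) (hbc : b ≠ c)
    (hbd : b ≠ d) (hcd : c ≠ d) : False := by
  have h1 : ({a, b, c, d} : Finset G) ⊆ T := by
    intro x hx; simp at hx; rcases hx with rfl | rfl | rfl | rfl <;> assumption
  have h2 := Finset.card_le_card h1
  have h3 : ({a, b, c, d} : Finset G).card = 4 := by
    rw [Finset.card_insert_of_notMem, Finset.card_insert_of_notMem, Finset.card_insert_of_notMem,
      Finset.card_singleton] <;> simp [*]
  omega

lemma one_notMem (hS : IsSRing S) {X : Finset G} (hX : X ∈ S) {g : G} (hg : g ∈ X) (hg1 : g ≠ 1) :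
    (1 : G) ∉ X := by
  intro h
  have := eq_of_mem hS hX hS.one_mem h (by simp)
  rw [this] at hg
  exact hg1 (by simpa using hg)

lemma sum_dif (hS : IsSRing S) {W : Finset G} (hW : W ∈ S) {w : G} (hw : w ∈ W)
    (T : Finset G) (hT : ∀ g ∈ T, lam W g = lam W w) (h1T : (1 : G) ∉ T) :
    W.card + T.card * lam W w + ∑ g ∈ (insert 1 T)ᶜ, lam W g = W.card * W.card := by
  rw [← sum_lam_univ, ← Finset.sum_add_sum_compl (insert 1 T), Finset.sum_insert h1T, lam_one,
    Finset.sum_congr rfl hT, Finset.sum_const, smul_eq_mul]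

lemma coset_three (D : DCtx G n z u) {T : Finset G} {y : G}
    (h : ∀ c ∈ Subgroup.zpowers z, y * c ∈ T) : 3 ≤ T.card := by
  have h1 : ({y, y * z, y * z ^ 2} : Finset G) ⊆ T := by
    intro x hx; simp at hx; rcases hx with rfl | rfl | rfl
    · simpa using h 1 (one_mem _)
    · exact h z ((D.memC _).2 (by simp))
    · exact h (z ^ 2) ((D.memC _).2 (by simp))
  have h2 := Finset.card_le_card h1
  have h3 : ({y, y * z, y * z ^ 2} : Finset G).card = 3 := by
    rw [Finset.card_insert_of_notMem, Finset.card_insert_of_notMem,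
      Finset.card_singleton] <;> simp [D.z1, D.z2, D.zz2]
  omega

end Ctx

end SR

namespace SR

section Ctx

variable {G : Type*} [CommGroup G] [Fintype G] {S : Finset (Finset G)} {n : ℕ} {z u : G}

lemma thmA_zinv (hS : IsSRing S) (D : DCtx G n z u) {W : Finset G} (hW : W ∈ S) (hz : z ∈ W)
    {y : G} (hy : y ∈ W) (hy3 : y ^ 3 ≠ 1) : ∀ c ∈ Subgroup.zpowers z, y * c ∈ W :=
  zinv hS D hW (k := 1) le_rfl hz (by simpa using D.z3) hy (by simpa using hy3)

lemma thmA_difE (hS : IsSRing S) (D : DCtx G n z u) {W : Finset G} (hW : W ∈ S) (hz : z ∈ W)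
    {x : G} (hx : x ∈ dif W z) : x ^ 3 = 1 := by
  by_contra h
  rw [mem_dif] at hx
  apply hx.2
  rw [mul_comm]
  exact thmA_zinv hS D hW hz hx.1 h _ (inv_mem (Subgroup.mem_zpowers _))

lemma thmA_sym (hS : IsSRing S) (D : DCtx G n z u) {W : Finset G} (hW : W ∈ S) (hz : z ∈ W)
    {y : G} (hy : y ∈ W) (hy3 : y ^ 3 ≠ 1) : z⁻¹ ∈ W := by
  by_contra hcon
  have hdisj : Disjoint W (W.image (·⁻¹)) := by
    rw [Finset.disjoint_left]
    intro x hx hx'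
    obtain ⟨a, ha, hax⟩ := Finset.mem_image.1 hx'
    apply hcon
    refine (inv_mem_of hS hW hW ha (?_ : a⁻¹ ∈ W) z).1 hz
    change a⁻¹ = x at hax
    rw [hax]; exact hx
  have hcard : (W ∪ W.image (·⁻¹)).card = 2 * W.card := by
    rw [Finset.card_union_of_disjoint hdisj, Finset.card_image_of_injective _ inv_injective]
    ring
  have h1W := one_notMem hS hW hz D.z1
  have h := sum_dif hS hW hz (W ∪ W.image (·⁻¹)) (by
    intro g hg
    rcases Finset.mem_union.1 hg with hg | hg
    · exact lam_eq hS (isU_of_mem hS hW) hW hg hz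
    · obtain ⟨a, ha, rfl⟩ := Finset.mem_image.1 hg
      change lam W a⁻¹ = _
      rw [lam_inv]
      exact lam_eq hS (isU_of_mem hS hW) hW ha hz) (by
    rw [Finset.mem_union]
    rintro (h | h)
    · exact h1W h
    · obtain ⟨a, ha, h⟩ := Finset.mem_image.1 h
      have : a = 1 := by simpa using h
      exact h1W (this ▸ ha))
  have hb := dif_z_card D (fun x hx => thmA_difE hS D hW hz hx)
  have hl := dif_add W z
  have h3 : 3 ≤ (W \ dif W z).card := by
    refine coset_three D (y := y) (fun c hc => ?_)
    rw [Finset.mem_sdiff]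
    refine ⟨thmA_zinv hS D hW hz hy hy3 c hc, fun h => hy3 ?_⟩
    have := thmA_difE hS D hW hz h
    rwa [mul_pow, D.C3 hc, mul_one] at this
  have h4 : (W \ dif W z).card + (dif W z).card = W.card :=
    Finset.card_sdiff_add_card_eq_card (Finset.filter_subset _ _)
  rw [hcard] at h
  have h5 : W.card * (1 + 2 * lam W z) ≤ W.card * W.card := by
    rw [← h, show W.card * (1 + 2 * lam W z) = W.card + 2 * W.card * lam W z by ring]
    exact Nat.le_add_right _ _
  have h6 := Nat.le_of_mul_le_mul_left h5 (by omega)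
  omega

lemma thmA_dcard (hS : IsSRing S) (D : DCtx G n z u) {W : Finset G} (hW : W ∈ S) (hz : z ∈ W)
    {y : G} (hy : y ∈ W) : (dif W y).card = (dif W z).card := by
  have h1 := dif_add W z
  have h2 := dif_add W y
  have h3 := lam_eq hS (isU_of_mem hS hW) hW hy hz
  omega

/-- If two elements of a coset of `C₁` behave differently. -/
lemma thmA_s2 (hS : IsSRing S) (D : DCtx G n z u) {W : Finset G} (hW : W ∈ S) (hz : z ∈ W)
    (hinv : ∀ x, x ∈ W ↔ x⁻¹ ∈ W)
    {v : G} (hv3 : v ^ 3 = 1) (hvC : v ∉ Subgroup.zpowers z)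
    (hv1 : v * z ∈ W) (hv2 : v⁻¹ * z ∈ W) (hv2' : v⁻¹ * z ^ 2 ∈ W) (hv0 : v⁻¹ ∉ W)
    {y : G} (hy : y ∈ W) (hy3 : y ^ 3 ≠ 1) : y * v ∈ W := by
  by_contra hcon
  have hd : (dif W y).card ≤ 3 := by
    rw [thmA_dcard hS D hW hz hy]
    exact dif_z_card D (fun x hx => thmA_difE hS D hW hz hx)
  have h1W := one_notMem hS hW hz D.z1
  have hzc := Subgroup.mem_zpowers z
  -- closure of complement
  have hC : ∀ e : G, e ^ 3 = 1 → y * e ∉ W → ∀ c ∈ Subgroup.zpowers z, y⁻¹ * (e⁻¹ * c) ∉ W := by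
    intro e he h c hc h'
    rw [hinv] at h'
    apply h
    have h3 : ((y⁻¹ * (e⁻¹ * c))⁻¹) ^ 3 ≠ 1 := by
      simp only [mul_inv, inv_inv, mul_pow, inv_pow, he, D.C3 hc]
      simpa using hy3
    have := thmA_zinv hS D hW hz h' h3 c hc
    convert this using 1
    simp only [mul_inv, inv_inv, mul_assoc, inv_mul_cancel, mul_one]
  have m1 : y ∈ dif W y := mem_dif.2 ⟨hy, by simpa using h1W⟩
  have m2 : v⁻¹ * z ∈ dif W y := mem_dif.2 ⟨hv2, hC v hv3 hcon _ hzc⟩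
  have m3 : v⁻¹ * z ^ 2 ∈ dif W y := mem_dif.2 ⟨hv2', hC v hv3 hcon _ (pow_mem hzc _)⟩
  have d1 : ∀ e : G, e ^ 3 = 1 → y ≠ e := by rintro e he rfl; exact hy3 he
  have hvi3 : v⁻¹ ^ 3 = 1 := by rw [inv_pow, hv3, inv_one]
  have e2 : (v⁻¹ * z) ^ 3 = 1 := by rw [mul_pow, hvi3, D.z3, one_mul]
  have e3 : (v⁻¹ * z ^ 2) ^ 3 = 1 := by rw [mul_pow, hvi3, D.C3 (pow_mem hzc _), one_mul]
  have d23 : v⁻¹ * z ≠ v⁻¹ * z ^ 2 := fun h => D.zz2 (mul_left_cancel h)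
  by_cases h : y * v⁻¹ ∈ W
  · have m4 : y * v⁻¹ ∈ dif W y := mem_dif.2 ⟨h, by simpa using hv0⟩
    have hne : ∀ e : G, e ^ 3 = 1 → e ≠ y * v⁻¹ := by
      rintro e he rfl
      rw [mul_pow, hvi3, mul_one] at he
      exact hy3 he
    refine four_contra hd m1 m2 m3 m4 (d1 _ e2) (d1 _ e3) ?_ d23 (hne _ e2) (hne _ e3)
    intro h'
    have : v⁻¹ = 1 := by simpa using h'
    rw [inv_eq_one] at this
    exact hvC (this ▸ one_mem _)
  · have m4 : v * z ∈ dif W y := mem_dif.2 ⟨hv1, by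
      simpa using hC v⁻¹ hvi3 h _ hzc⟩
    have hne : ∀ c ∈ Subgroup.zpowers z, v⁻¹ * c ≠ v * z := by
      intro c hc h'
      apply hvC
      have h2 : v ^ 2 * z = c := by
        rw [pow_two, mul_assoc, ← h', mul_inv_cancel_left]
      have h3 : v = (v ^ 2 * z)⁻¹ * z := by
        rw [mul_inv, mul_assoc, inv_mul_cancel, mul_one, eq_inv_iff_mul_eq_one, ← pow_succ', hv3]
      rw [h3, h2]
      exact mul_mem (inv_mem hc) hzc
    exact four_contra hd m1 m2 m3 m4 (d1 _ e2) (d1 _ e3) (d1 _ (by rw [mul_pow, hv3, D.z3, one_mul]))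
      d23 (hne _ hzc) (hne _ (pow_mem hzc _))

lemma thmA_s1 (hS : IsSRing S) (D : DCtx G n z u) {W : Finset G} (hW : W ∈ S) (hz : z ∈ W)
    (hinv : ∀ x, x ∈ W ↔ x⁻¹ ∈ W)
    {v : G} (hv3 : v ^ 3 = 1) (hvC : v ∉ Subgroup.zpowers z)
    (hv0 : v ∈ W) (hv1 : v * z ∉ W) (hv2 : v * z ^ 2 ∉ W) (hv1' : v⁻¹ * z ∉ W)
    {y : G} (hy : y ∈ W) (hy3 : y ^ 3 ≠ 1) : y * v ∉ W := by
  intro hcon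
  have hd : (dif W y).card ≤ 3 := by
    rw [thmA_dcard hS D hW hz hy]
    exact dif_z_card D (fun x hx => thmA_difE hS D hW hz hx)
  have h1W := one_notMem hS hW hz D.z1
  have hzc := Subgroup.mem_zpowers z
  have hyv3 : (y * v) ^ 3 ≠ 1 := by rwa [mul_pow, hv3, mul_one]
  have m1 : y ∈ dif W y := mem_dif.2 ⟨hy, by simpa using h1W⟩
  have m2 : y * (v * z) ∈ dif W y := mem_dif.2 ⟨by
    rw [← mul_assoc]; exact thmA_zinv hS D hW hz hcon hyv3 _ hzc, by simpa using hv1⟩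
  have m3 : y * (v * z ^ 2) ∈ dif W y := mem_dif.2 ⟨by
    rw [← mul_assoc]; exact thmA_zinv hS D hW hz hcon hyv3 _ (pow_mem hzc _), by simpa using hv2⟩
  have hne : ∀ c ∈ Subgroup.zpowers z, y ≠ y * (v * c) := by
    intro c hc h
    have : v * c = 1 := by simpa using h
    apply hvC
    rw [eq_inv_of_mul_eq_one_left this]
    exact inv_mem hc
  have d23 : y * (v * z) ≠ y * (v * z ^ 2) := fun h => D.zz2 (mul_left_cancel (mul_left_cancel h))
  by_cases h : y * v⁻¹ ∈ W
  · have hyv3' : (y * v⁻¹) ^ 3 ≠ 1 := by rwa [mul_pow, inv_pow, hv3, inv_one, mul_one]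
    have m4 : y * (v⁻¹ * z) ∈ dif W y := mem_dif.2 ⟨by
      rw [← mul_assoc]; exact thmA_zinv hS D hW hz h hyv3' _ hzc, by simpa using hv1'⟩
    have hne2 : ∀ c ∈ Subgroup.zpowers z, y * (v * c) ≠ y * (v⁻¹ * z) := by
      intro c hc h'
      have h' := mul_left_cancel h'
      apply hvC
      have h2 : v ^ 2 * c = z := by
        rw [pow_two, mul_assoc, h', mul_inv_cancel_left]
      have h3 : v = (v ^ 2 * c)⁻¹ * c := by
        rw [mul_inv, mul_assoc, inv_mul_cancel, mul_one, eq_inv_iff_mul_eq_one, ← pow_succ', hv3]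
      rw [h3, h2]
      exact mul_mem (inv_mem hzc) hc
    refine four_contra hd m1 m2 m3 m4 (hne _ hzc) (hne _ (pow_mem hzc _)) ?_ d23
      (hne2 _ hzc) (hne2 _ (pow_mem hzc _))
    intro h'
    have : v⁻¹ * z = 1 := by simpa using h'
    apply hvC
    rw [inv_mul_eq_one.1 this]
    exact hzc
  · have m4 : v ∈ dif W y := mem_dif.2 ⟨hv0, fun h' => h (by
      rw [hinv] at h'; simpa [mul_comm] using h')⟩
    have hne2 : ∀ c : G, c ^ 3 = 1 → y * c ≠ v := by
      rintro c hc rfl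
      rw [mul_pow, hc, mul_one] at hv3
      exact hy3 hv3
    refine four_contra hd m1 m2 m3 m4 (hne _ hzc) (hne _ (pow_mem hzc _)) ?_ d23
      (hne2 _ ?_) (hne2 _ ?_)
    · rintro rfl; exact hy3 hv3
    · rw [mul_pow, hv3, D.z3, one_mul]
    · rw [mul_pow, hv3, D.C3 (pow_mem hzc _), one_mul]

lemma mem_sf {K : Subgroup G} {g : G} : g ∈ subgroupFinset K ↔ g ∈ K := by
  simp [subgroupFinset]

lemma thmA_b1 (hS : IsSRing S) (D : DCtx G n z u) {W : Finset G} (hW : W ∈ S) (hz : z ∈ W)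
    (hinv : ∀ x, x ∈ W ↔ x⁻¹ ∈ W)
    (hC : ∀ x ∈ dif W z, x ∈ Subgroup.zpowers z) :
    ∃ K : Subgroup G, IsU S (subgroupFinset K) ∧ ∀ g, g ∈ W ↔ g ∈ K ∧ g ≠ 1 := by
  have h1W := one_notMem hS hW hz D.z1
  have hzd : z ∈ dif W z := mem_dif.2 ⟨hz, by simpa using h1W⟩
  have hd : dif W z = {z} := by
    ext x
    rw [Finset.mem_singleton]
    constructor
    · intro hx
      have h2 : z⁻¹ * x ∈ Subgroup.zpowers z :=
        mul_mem (inv_mem (Subgroup.mem_zpowers z)) (hC x hx)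
      have := dif_z_unique D hzd h2 (by simpa using hx)
      exact (inv_mul_eq_one.1 this).symm
    · rintro rfl; exact hzd
  have hl := dif_add W z
  rw [hd, Finset.card_singleton] at hl
  have h := sum_dif hS hW hz W (fun g hg => lam_eq hS (isU_of_mem hS hW) hW hg hz) h1W
  have h0 : ∑ g ∈ (insert 1 W)ᶜ, lam W g = 0 := by
    have : W.card + W.card * lam W z = W.card * W.card := by
      rw [← hl]; ring
    omega
  rw [Finset.sum_eq_zero_iff] at h0
  let K : Subgroup G := Subgroup.ofDiv ((insert 1 W : Finset G) : Set G) ⟨1, by simp⟩ (by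
    intro x hx y hy
    simp only [Finset.coe_insert, Set.mem_insert_iff, Finset.mem_coe] at hx hy ⊢
    rcases hx with rfl | hx
    · rcases hy with rfl | hy
      · simp
      · right; rw [one_mul]; exact (hinv y).1 hy
    · rcases hy with rfl | hy
      · right; simpa using hx
      · by_contra hcon
        have := h0 (x * y⁻¹) (by simpa using hcon)
        unfold lam at this
        rw [Finset.card_eq_zero] at this
        have hx' : x ∈ W.filter (fun a => (x * y⁻¹)⁻¹ * a ∈ W) := by
          simp [hx, hy]
        rw [this] at hx'
        simp at hx')
  have hKm : ∀ g, g ∈ K ↔ g = 1 ∨ g ∈ W := by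
    intro g
    change g ∈ ((insert 1 W : Finset G) : Set G) ↔ _
    simp
  refine ⟨K, ?_, ?_⟩
  · intro Y hY g hg hgK y hy
    rw [mem_sf, hKm] at hgK ⊢
    rcases hgK with rfl | hgK
    · have := eq_of_mem hS hY hS.one_mem hg (by simp)
      rw [this] at hy
      left; simpa using hy
    · right
      rwa [eq_of_mem hS hW hY hgK hg]
  · intro g
    rw [hKm]
    constructor
    · intro h; exact ⟨Or.inr h, fun h' => h1W (h' ▸ h)⟩
    · rintro ⟨rfl | h, h'⟩
      · exact absurd rfl h'
      · exact h

lemma thmA_b3 (hS : IsSRing S) (D : DCtx G n z u) {W : Finset G} (hW : W ∈ S) (hz : z ∈ W)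
    (hinv : ∀ x, x ∈ W ↔ x⁻¹ ∈ W) {y : G} (hy : y ∈ W) (hy3 : y ^ 3 ≠ 1)
    {e : G} (he : e ∈ dif W z) (heC : e ∉ Subgroup.zpowers z) :
    ∃ K : Subgroup G, IsU S (subgroupFinset K) ∧ (∀ g : G, g ^ 3 = 1 → g ∈ K) ∧
      ∃ v : G, v ^ 3 = 1 ∧ ∀ g, g ∈ W ↔ g ∈ K ∧ g ∉ Subgroup.zpowers v := by
  have he3 := thmA_difE hS D hW hz he
  rw [mem_dif] at he
  obtain ⟨he, he'⟩ := he
  rw [D.zinv2, mul_comm] at he'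
  have hzc := Subgroup.mem_zpowers z
  have h1W := one_notMem hS hW hz D.z1
  have hz2W : z ^ 2 ∈ W := by rw [← D.zinv2]; exact (hinv z).1 hz
  have hz2i : (z ^ 2)⁻¹ = z := by rw [← D.zinv2, inv_inv]
  have hi : ∀ a b : G, a * b ∈ W ↔ a⁻¹ * b⁻¹ ∈ W := fun a b => by rw [hinv, mul_inv]
  by_cases hez : e * z ∈ W
  · -- the case of two elements per coset
    obtain ⟨v, rfl⟩ : ∃ v, e = v * z := ⟨e * z⁻¹, by simp⟩
    have hv3 : v ^ 3 = 1 := by rwa [mul_pow, D.z3, mul_one] at he3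
    have hvC : v ∉ Subgroup.zpowers z := fun h => heC (mul_mem h hzc)
    have hvi3 : v⁻¹ ^ 3 = 1 := by rw [inv_pow, hv3, inv_one]
    have hviC : v⁻¹ ∉ Subgroup.zpowers z := fun h => hvC (by simpa using h)
    have hv0 : v ∉ W := by
      rwa [mul_assoc, ← pow_succ', D.z3, mul_one] at he'
    have hvz2 : v * z ^ 2 ∈ W := by rwa [pow_two, ← mul_assoc]
    have hvi0 : v⁻¹ ∉ W := fun h => hv0 ((hinv v).2 h)
    have hviz : v⁻¹ * z ∈ W := by rw [hi, inv_inv, D.zinv2]; exact hvz2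
    have hviz2 : v⁻¹ * z ^ 2 ∈ W := by rw [hi, inv_inv, hz2i]; exact he
    have hinE : ∀ x ∈ W, x ^ 3 ≠ 1 → ∀ g : G, g ^ 3 = 1 → x * g ∈ W := by
      intro x hx hx3 g hg
      have a1 : ∀ c ∈ Subgroup.zpowers z, x * v * c ∈ W := by
        refine thmA_zinv hS D hW hz (thmA_s2 hS D hW hz hinv hv3 hvC he hviz hviz2 hvi0 hx hx3) ?_
        rwa [mul_pow, hv3, mul_one]
      have a2 : ∀ c ∈ Subgroup.zpowers z, x * v⁻¹ * c ∈ W := by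
        refine thmA_zinv hS D hW hz (thmA_s2 hS D hW hz hinv hvi3 hviC hviz (by simpa using he)
          (by simpa using hvz2) (by simpa using hv0) hx hx3) ?_
        rwa [mul_pow, hvi3, mul_one]
      rcases D.ecov' hv3 hvC hg with h | h | h
      · exact thmA_zinv hS D hW hz hx hx3 _ h
      · have := a2 _ h
        rwa [mul_assoc, inv_mul_cancel_left] at this
      · have := a1 _ h
        rwa [mul_assoc, mul_inv_cancel_left] at this
    have hdy : ∀ x ∈ W, x ^ 3 ≠ 1 → dif W x = {x, x * v, x * v⁻¹} := by
      intro x hx hx3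
      symm
      apply Finset.eq_of_subset_of_card_le
      · intro t ht
        simp only [Finset.mem_insert, Finset.mem_singleton] at ht
        rw [mem_dif]
        rcases ht with rfl | rfl | rfl
        · exact ⟨hx, by simpa using h1W⟩
        · exact ⟨hinE x hx hx3 _ hv3, by simpa using hv0⟩
        · exact ⟨hinE x hx hx3 _ hvi3, by simpa using hvi0⟩
      · rw [thmA_dcard hS D hW hz hx]
        have hv1 : v ≠ 1 := fun h => hvC (h ▸ one_mem _)
        have hvv : v ≠ v⁻¹ := by
          intro h
          apply hv1
          have h2 : v * v = 1 := by nth_rw 2 [h]; simp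
          calc v = v * v * v := by rw [h2, one_mul]
            _ = v ^ 3 := by rw [pow_succ, pow_two]
            _ = 1 := hv3
        have : ({x, x * v, x * v⁻¹} : Finset G).card = 3 := by
          rw [Finset.card_insert_of_notMem, Finset.card_insert_of_notMem,
            Finset.card_singleton] <;> simp [hv1, hvv]
        rw [this]
        exact dif_z_card D (fun x hx => thmA_difE hS D hW hz hx)
    have hquot : ∀ x ∈ W, x ^ 3 ≠ 1 → ∀ w ∈ W, x⁻¹ * w ∈ W ∨ (x⁻¹ * w) ^ 3 = 1 := by
      intro x hx hx3 w hw
      by_contra hcon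
      push Not at hcon
      have : w ∈ dif W x := mem_dif.2 ⟨hw, hcon.1⟩
      rw [hdy x hx hx3] at this
      simp only [Finset.mem_insert, Finset.mem_singleton] at this
      apply hcon.2
      rcases this with rfl | rfl | rfl
      · simp
      · simpa using hv3
      · simpa using hv3
    let K : Subgroup G := Subgroup.ofDiv {g | g ∈ W ∨ g ^ 3 = 1} ⟨1, by simp⟩ (by
      intro x hx w hw
      simp only [Set.mem_setOf_eq] at hx hw ⊢
      by_cases hw3 : w ^ 3 = 1
      · have hwi : w⁻¹ ^ 3 = 1 := by rw [inv_pow, hw3, inv_one]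
        by_cases hx3 : x ^ 3 = 1
        · right; rw [mul_pow, hx3, hwi, one_mul]
        · left
          exact hinE x (hx.resolve_right hx3) hx3 _ hwi
      · have hw := hw.resolve_right hw3
        by_cases hx3 : x ^ 3 = 1
        · left
          rw [mul_comm]
          refine hinE w⁻¹ ((hinv w).1 hw) ?_ _ hx3
          rw [inv_pow, Ne, inv_eq_one]; exact hw3
        · have := hquot w hw hw3 x (hx.resolve_right hx3)
          rwa [mul_comm] at this)
    have hKm : ∀ g, g ∈ K ↔ g ∈ W ∨ g ^ 3 = 1 := fun g => Iff.rfl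
    have hKcl : K = Subgroup.closure (W : Set G) := by
      apply le_antisymm
      · intro g hg
        rw [hKm] at hg
        rcases hg with hg | hg
        · exact Subgroup.subset_closure hg
        · have h1 : y * g ∈ Subgroup.closure (W : Set G) :=
            Subgroup.subset_closure (hinE y hy hy3 g hg)
          have h2 : y ∈ Subgroup.closure (W : Set G) := Subgroup.subset_closure hy
          simpa using mul_mem (inv_mem h2) h1
      · rw [Subgroup.closure_le]
        intro g hg
        exact (hKm g).2 (Or.inl hg)
    refine ⟨K, ?_, fun g hg => (hKm g).2 (Or.inr hg), v, hv3, ?_⟩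
    · rw [hKcl]; exact isU_closure hS (isU_of_mem hS hW)
    · have hV : ∀ g, g ∈ Subgroup.zpowers v ↔ g = 1 ∨ g = v ∨ g = v⁻¹ := by
        intro g
        constructor
        · intro h
          obtain ⟨t, ht⟩ := mem_powers_iff_mem_zpowers.2 h
          change v ^ t = g at ht
          have h3 : v ^ t = v ^ (t % 3) := by
            conv_lhs => rw [← Nat.div_add_mod t 3, pow_add, pow_mul, hv3, one_pow, one_mul]
          have : t % 3 < 3 := Nat.mod_lt _ (by norm_num)
          have hvi : v⁻¹ = v ^ 2 := by rw [inv_eq_iff_mul_eq_one, ← pow_succ', hv3]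
          rw [← ht, h3, hvi]
          interval_cases t % 3 <;> simp
        · rintro (rfl | rfl | rfl)
          · exact one_mem _
          · exact Subgroup.mem_zpowers _
          · exact inv_mem (Subgroup.mem_zpowers _)
      intro g
      rw [hKm, hV]
      constructor
      · intro hg
        refine ⟨Or.inl hg, ?_⟩
        rintro (rfl | rfl | rfl)
        · exact h1W hg
        · exact hv0 hg
        · exact hvi0 hg
      · rintro ⟨hg | hg, hg'⟩
        · exact hg
        · push Not at hg'
          rcases D.ecov' hv3 hvC hg with h | h | h <;> rcases (D.memC _).1 h with h | h | h
          · exact absurd h hg'.1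
          · exact h ▸ hz
          · exact h ▸ hz2W
          · exact absurd (eq_inv_of_mul_eq_one_right h) hg'.2.2
          · rw [← eq_inv_mul_iff_mul_eq] at h; rw [h]; exact hviz
          · rw [← eq_inv_mul_iff_mul_eq] at h; rw [h]; exact hviz2
          · exact absurd (inv_mul_eq_one.1 h).symm hg'.2.1
          · rw [inv_mul_eq_iff_eq_mul] at h; rw [h]; exact he
          · rw [inv_mul_eq_iff_eq_mul] at h; rw [h]; exact hvz2
  · -- the case of one element per coset is impossible
    exfalso
    have hei3 : e⁻¹ ^ 3 = 1 := by rw [inv_pow, he3, inv_one]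
    have hei : e⁻¹ * z ∉ W := by rw [hi, inv_inv, D.zinv2]; exact he'
    have key : ∀ x ∈ W, x ^ 3 ≠ 1 → x * e ∉ W := fun x hx hx3 =>
      thmA_s1 hS D hW hz hinv he3 heC he hez he' hei hx hx3
    have hsub : ∀ x ∈ W, x ^ 3 ≠ 1 → x ∈ dif W e := by
      intro x hx hx3
      refine mem_dif.2 ⟨hx, fun h => ?_⟩
      refine key _ h ?_ (by rw [mul_comm, mul_inv_cancel_left]; exact hx)
      rwa [mul_pow, hei3, one_mul]
    have hd : (dif W e).card ≤ 3 := by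
      rw [thmA_dcard hS D hW hz he]
      exact dif_z_card D (fun x hx => thmA_difE hS D hW hz hx)
    have hyi3 : y⁻¹ ^ 3 ≠ 1 := by rw [inv_pow, Ne, inv_eq_one]; exact hy3
    have hyz : ∀ c ∈ Subgroup.zpowers z, y * c ∈ dif W e := fun c hc =>
      hsub _ (thmA_zinv hS D hW hz hy hy3 c hc) (by rwa [mul_pow, D.C3 hc, mul_one])
    have hyiz := hsub _ ((hinv y).1 hy) hyi3
    have hne : ∀ c ∈ Subgroup.zpowers z, y * c ≠ y⁻¹ := by
      intro c hc h
      have h2 : y * y = c⁻¹ := by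
        rw [eq_inv_iff_mul_eq_one, mul_assoc, h, mul_inv_cancel]
      have h3 : (y * y) ^ 3 = 1 := by rw [h2]; exact D.C3 (inv_mem hc)
      -- the order of `y` is a power of three
      have h6 : (y ^ 3) ^ 2 = 1 := by rw [← pow_mul, mul_comm, pow_mul, pow_two, h3]
      apply hy3
      have h7 : (y ^ 3) ^ 3 ^ n = 1 := D.pown _
      have h8 : orderOf (y ^ 3) ∣ Nat.gcd 2 (3 ^ n) :=
        Nat.dvd_gcd (orderOf_dvd_of_pow_eq_one h6) (orderOf_dvd_of_pow_eq_one h7)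
      rw [show Nat.gcd 2 (3 ^ n) = 1 from Nat.Coprime.pow_right n (by norm_num)] at h8
      exact orderOf_eq_one_iff.1 (Nat.dvd_one.1 h8)
    refine four_contra hd (hyz 1 (one_mem _)) (hyz z hzc) (hyz _ (pow_mem hzc 2)) hyiz ?_ ?_
      (hne _ (one_mem _)) ?_ (hne _ hzc) (hne _ (pow_mem hzc 2))
    · intro h; exact D.z1 (mul_left_cancel h).symm
    · intro h; exact D.z2 (mul_left_cancel h).symm
    · intro h; exact D.zz2 (mul_left_cancel h)

theorem thmA (hS : IsSRing S) (D : DCtx G n z u) {W : Finset G} (hW : W ∈ S) (hz : z ∈ W)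
    {y : G} (hy : y ∈ W) (hy3 : y ^ 3 ≠ 1) :
    ∃ K : Subgroup G, IsU S (subgroupFinset K) ∧
      (((∀ g ∈ K, g ^ 3 = 1 → g ∈ Subgroup.zpowers z) ∧ ∀ g, g ∈ W ↔ g ∈ K ∧ g ≠ 1) ∨
      ((∀ g : G, g ^ 3 = 1 → g ∈ K) ∧
      ∃ v : G, v ^ 3 = 1 ∧ ∀ g, g ∈ W ↔ g ∈ K ∧ g ∉ Subgroup.zpowers v)) := by
  have hinv := inv_mem_of hS hW hW hz (thmA_sym hS D hW hz hy hy3)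
  by_cases h : ∀ x ∈ dif W z, x ∈ Subgroup.zpowers z
  · obtain ⟨K, hK, hKW⟩ := thmA_b1 hS D hW hz hinv h
    refine ⟨K, hK, ?_⟩
    by_cases hE : ∀ g ∈ K, g ^ 3 = 1 → g ∈ Subgroup.zpowers z
    · exact Or.inl ⟨hE, hKW⟩
    · right
      push Not at hE
      obtain ⟨v, hvK, hv3, hvC⟩ := hE
      have hCK : ∀ c ∈ Subgroup.zpowers z, c ∈ K :=
        fun c hc => (Subgroup.zpowers_le.2 ((hKW z).1 hz).1) hc
      refine ⟨?_, 1, one_pow _, ?_⟩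
      · intro g hg
        rcases D.ecov' hv3 hvC hg with h | h | h
        · exact hCK _ h
        · simpa using mul_mem (inv_mem hvK) (hCK _ h)
        · simpa using mul_mem hvK (hCK _ h)
      · intro g
        rw [hKW]; simp
  · push Not at h
    obtain ⟨e, he, heC⟩ := h
    obtain ⟨K, hK, h⟩ := thmA_b3 hS D hW hz hinv hy hy3 he heC
    exact ⟨K, hK, Or.inr h⟩

end Ctx

end SR

namespace SR

section Ctx

variable {G : Type*} [CommGroup G] [Fintype G] {S : Finset (Finset G)} {n : ℕ} {z u : G}

lemma mem_cos {X : Finset G} {K : Subgroup G} {g x : G} : x ∈ cos X K g ↔ x ∈ X ∧ x⁻¹ * g ∈ K := by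
  simp [cos]

lemma inv_mul_mem_comm {K : Subgroup G} {a b : G} : a⁻¹ * b ∈ K ↔ b⁻¹ * a ∈ K := by
  rw [← inv_mem_iff, mul_inv, inv_inv, mul_comm]

/-- Cardinality of the missing part of a coset. -/
lemma cos_compl (X : Finset G) (K : Subgroup G) (g : G) :
    (cos X K g).card + (cos Xᶜ K g).card = (subgroupFinset K).card := by
  have h : (cos (Finset.univ) K g).card = (subgroupFinset K).card := by
    refine Finset.card_bij (fun x _ => x⁻¹ * g) ?_ ?_ ?_
    · intro x hx; exact mem_sf.2 (mem_cos.1 hx).2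
    · intro a _ b _ h; simpa using h
    · intro b hb
      refine ⟨g * b⁻¹, mem_cos.2 ⟨Finset.mem_univ _, ?_⟩, ?_⟩
      · simpa using mem_sf.1 hb
      · simp
  rw [← h, ← Finset.card_union_of_disjoint]
  · congr 1
    ext x
    simp only [Finset.mem_union, mem_cos, Finset.mem_compl, Finset.mem_univ, true_and]
    tauto
  · rw [Finset.disjoint_left]
    intro x h1 h2
    exact (Finset.mem_compl.1 (mem_cos.1 h2).1) (mem_cos.1 h1).1

lemma lemC (hS : IsSRing S) {W X : Finset G} (hW : W ∈ S) (hz : z ∈ W) (hX : X ∈ S)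
    {K : Subgroup G} (hK : IsU S (subgroupFinset K)) (hKW : ∀ g, g ∈ W ↔ g ∈ K ∧ g ≠ 1)
    {y : G} (hy : y ∈ X) {t : ℕ} (ht : ∀ x ∈ X, (cos (dif X z) K x).card ≤ t) :
    (cos X K y).card * (subgroupFinset K).card + t ≤
      t * (subgroupFinset K).card + (cos X K y).card * (cos X K y).card := by
  set r := (cos X K y).card with hr
  set κ := (subgroupFinset K).card with hκ
  have h1 := sum_lam_sub hS hX hK hy
  have hKi : subgroupFinset K = insert 1 W := by
    ext g
    rw [mem_sf, Finset.mem_insert, hKW]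
    by_cases h : g = 1
    · subst h; simp [one_mem]
    · simp [h]
  have h1W : (1 : G) ∉ W := fun h => ((hKW 1).1 h).2 rfl
  have hκW : κ = W.card + 1 := by rw [hκ, hKi, Finset.card_insert_of_notMem h1W]
  rw [hKi, Finset.sum_insert h1W, lam_one,
    Finset.sum_congr rfl (fun g hg => lam_eq hS (isU_of_mem hS hX) hW hg hz), Finset.sum_const,
    smul_eq_mul, ← hr] at h1
  have h2 := dif_add X z
  -- double count
  have h3 : (dif X z).card * r ≤ X.card * t := by
    have e1 : ∑ b ∈ dif X z, (cos X K b).card = (dif X z).card * r := by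
      rw [Finset.sum_const_nat]
      intro b hb
      exact cos_card hS hX hK (mem_dif.1 hb).1 hy
    have e2 : ∑ b ∈ dif X z, (cos X K b).card = ∑ x ∈ X, (cos (dif X z) K x).card := by
      unfold cos
      simp only [Finset.card_filter]
      rw [Finset.sum_comm]
      refine Finset.sum_congr rfl (fun x _ => Finset.sum_congr rfl (fun b _ => ?_))
      simp only [inv_mul_mem_comm]
    rw [← e1, e2]
    calc ∑ x ∈ X, (cos (dif X z) K x).card ≤ ∑ x ∈ X, t := Finset.sum_le_sum ht
      _ = X.card * t := by simp
  have hXpos : 0 < X.card := Finset.card_pos.2 ⟨y, hy⟩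
  refine Nat.le_of_mul_le_mul_left (c := X.card) ?_ hXpos
  generalize X.card = c at *
  generalize (dif X z).card = b at *
  generalize lam X z = l at *
  generalize W.card = w at *
  rw [hκW]
  zify at *
  have e : (c : ℤ) * (w + 1 - r) = w * b := by
    rw [show (b : ℤ) = c - l by linarith]; linarith
  have : (w : ℤ) * (b * r) ≤ w * (c * t) := mul_le_mul_of_nonneg_left h3 (by positivity)
  nlinarith

lemma lemJ (hS : IsSRing S) (D : DCtx G n z u) {W X : Finset G} (hW : W ∈ S) (hz : z ∈ W)
    (hX : X ∈ S) {K : Subgroup G} (hK : IsU S (subgroupFinset K))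
    (hKW : ∀ g, g ∈ W ↔ g ∈ K ∧ g ≠ 1)
    (hKE : ∀ g ∈ K, g ^ 3 = 1 → g ∈ Subgroup.zpowers z)
    {x0 y : G} (hx0 : x0 ∈ X) (hx03 : x0 ^ 3 = 1) (hy : y ∈ X) (hy3 : y ^ 3 ≠ 1)
    (hrad : ∀ g : G, (∀ x ∈ X, g * x ∈ X) → g = 1) {x : G} (hx : x ∈ X) :
    ∃ m : G, x⁻¹ * m ∈ K ∧ m ∉ X ∧ ∀ a, x⁻¹ * a ∈ K → a ∉ X → a = m := by
  have hzK : z ∈ K := ((hKW z).1 hz).1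
  have hinv : ∀ w ∈ X, w ^ 3 ≠ 1 → ∀ c ∈ Subgroup.zpowers z, w * c ∈ X := fun w hw hw3 =>
    zinv hS D hX (k := 1) le_rfl hx0 (by simpa using hx03) hw (by simpa using hw3)
  have hBE : ∀ b ∈ dif X z, b ^ 3 = 1 := by
    intro b hb
    rw [mem_dif] at hb
    by_contra h
    exact hb.2 (by rw [mul_comm]; exact hinv b hb.1 h _ (inv_mem (Subgroup.mem_zpowers z)))
  have ht : ∀ x ∈ X, (cos (dif X z) K x).card ≤ 1 := by
    intro x _
    rw [Finset.card_le_one]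
    intro a ha b hb
    rw [mem_cos] at ha hb
    have h1 : a⁻¹ * b ∈ K := by
      have := mul_mem ha.2 (inv_mem hb.2)
      convert this using 1
      rw [mul_inv, inv_inv, mul_assoc, mul_comm b, mul_inv_cancel_left]
    have h2 := hKE _ h1 (by rw [mul_pow, inv_pow, hBE a ha.1, hBE b hb.1]; simp)
    have := dif_z_unique D ha.1 h2 (by simpa using hb.1)
    exact inv_mul_eq_one.1 this
  have hC := lemC hS hW hz hX hK hKW hx ht
  have hcK : ∀ c ∈ Subgroup.zpowers z, c ∈ K := fun c hc => (Subgroup.zpowers_le.2 hzK) hc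
  have h3 : 3 ≤ (cos X K x).card := by
    rw [cos_card hS hX hK hx hy]
    refine coset_three D (y := y) (fun c hc => mem_cos.2 ⟨hinv y hy hy3 c hc, ?_⟩)
    rw [mul_inv, mul_comm y⁻¹, mul_assoc, inv_mul_cancel, mul_one]
    exact inv_mem (hcK c hc)
  have hsum := cos_compl X K x
  have hne : (cos Xᶜ K x).card ≠ 0 := by
    intro h0
    apply D.z1
    apply hrad
    intro w hw
    have h4 := cos_compl X K w
    rw [cos_card hS hX hK hw hx] at h4
    have h5 : (cos Xᶜ K w).card = 0 := by omega
    by_contra hcon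
    have : z * w ∈ cos Xᶜ K w := by
      rw [mem_cos, Finset.mem_compl]
      refine ⟨hcon, ?_⟩
      rw [mul_inv, inv_mul_cancel_right]
      exact inv_mem hzK
    rw [Finset.card_eq_zero.1 h5] at this
    simp at this
  have h1 : (cos Xᶜ K x).card = 1 := by
    by_contra h
    obtain ⟨q, hq⟩ : ∃ q, (cos Xᶜ K x).card = q + 2 := ⟨(cos Xᶜ K x).card - 2, by omega⟩
    obtain ⟨p, hp⟩ : ∃ p, (cos X K x).card = p + 3 := ⟨(cos X K x).card - 3, by omega⟩
    rw [← hsum, hp, hq] at hC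
    nlinarith
  obtain ⟨m, hm⟩ := Finset.card_eq_one.1 h1
  have hmem : ∀ a, a ∈ cos Xᶜ K x ↔ x⁻¹ * a ∈ K ∧ a ∉ X := by
    intro a
    rw [mem_cos, Finset.mem_compl, inv_mul_mem_comm]
    tauto
  have hm' : m ∈ cos Xᶜ K x := by rw [hm]; simp
  refine ⟨m, ((hmem m).1 hm').1, ((hmem m).1 hm').2, fun a h1 h2 => ?_⟩
  have := (hmem a).2 ⟨h1, h2⟩
  rw [hm] at this
  simpa using this

lemma noC1 (hS : IsSRing S) (D : DCtx G n z u) {X : Finset G} (hX : X ∈ S)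
    (hC : IsU S (subgroupFinset (Subgroup.zpowers z))) {y : G} (hy : y ∈ X)
    (hyC : ∀ c ∈ Subgroup.zpowers z, y * c ∈ X) : ∀ x ∈ X, z * x ∈ X := by
  intro x hx
  have h1 := cos_compl X (Subgroup.zpowers z) x
  have h2 := cos_compl X (Subgroup.zpowers z) y
  have h3 := cos_card hS hX hC hx hy
  have h4 : (cos Xᶜ (Subgroup.zpowers z) y).card = 0 := by
    rw [Finset.card_eq_zero, Finset.eq_empty_iff_forall_notMem]
    intro a ha
    rw [mem_cos, Finset.mem_compl] at ha
    apply ha.1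
    have := hyC _ (inv_mem ha.2)
    simpa using this
  by_contra hcon
  have h5 : z * x ∈ cos Xᶜ (Subgroup.zpowers z) x := by
    rw [mem_cos, Finset.mem_compl]
    refine ⟨hcon, ?_⟩
    rw [mul_inv, inv_mul_cancel_right]
    exact inv_mem (Subgroup.mem_zpowers z)
  have : 0 < (cos Xᶜ (Subgroup.zpowers z) x).card := Finset.card_pos.2 ⟨_, h5⟩
  omega

/-- The subgroup of elements of order dividing three. -/
def E3 (G : Type*) [CommGroup G] : Subgroup G := (powMonoidHom 3 : G →* G).ker

lemma mem_E3 {g : G} : g ∈ E3 G ↔ g ^ 3 = 1 := by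
  rw [E3, MonoidHom.mem_ker]; rfl

/-- If the basic set of `z` consists of elements of order three, then `E` is an `A`-subgroup. -/
lemma E_sub (hS : IsSRing S) (D : DCtx G n z u) {W X : Finset G} (hW : W ∈ S) (hz : z ∈ W)
    (hWE : ∀ w ∈ W, w ^ 3 = 1) (hX : X ∈ S) {y : G} (hy : y ∈ X)
    (hyC : ∀ c ∈ Subgroup.zpowers z, y * c ∈ X)
    (hrad : ∀ g : G, (∀ x ∈ X, g * x ∈ X) → g = 1) :
    IsU S (subgroupFinset (E3 G)) ∧ ∃ w ∈ W, w ∉ Subgroup.zpowers z := by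
  have hcl := isU_closure hS (isU_of_mem hS hW)
  have hz' : z ∈ Subgroup.closure (W : Set G) := Subgroup.subset_closure hz
  have hCle : Subgroup.zpowers z ≤ Subgroup.closure (W : Set G) := Subgroup.zpowers_le.2 hz'
  have hex : ∃ w ∈ W, w ∉ Subgroup.zpowers z := by
    by_contra hcon
    push Not at hcon
    have : Subgroup.closure (W : Set G) = Subgroup.zpowers z :=
      le_antisymm ((Subgroup.closure_le _).2 hcon) hCle
    rw [this] at hcl
    exact D.z1 (hrad z (noC1 hS D hX hcl hy hyC))
  refine ⟨?_, hex⟩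
  obtain ⟨w, hw, hwC⟩ := hex
  have : Subgroup.closure (W : Set G) = E3 G := by
    apply le_antisymm
    · rw [Subgroup.closure_le]
      intro g hg
      exact mem_E3.2 (hWE g hg)
    · intro g hg
      have hw' : w ∈ Subgroup.closure (W : Set G) := Subgroup.subset_closure hw
      rcases D.ecov' (hWE w hw) hwC (mem_E3.1 hg) with h | h | h
      · exact hCle h
      · simpa using mul_mem (inv_mem hw') (hCle h)
      · simpa using mul_mem hw' (hCle h)
  rwa [this] at hcl

end Ctx

end SR

namespace SR

section Ctx

variable {G : Type*} [CommGroup G] [Fintype G] {S : Finset (Finset G)} {n : ℕ} {z u : G}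

lemma DCtx.pow_eq_one (D : DCtx G n z u) {m : ℕ} (hm : ¬ 3 ∣ m) {g : G} (h : g ^ m = 1) : g = 1 := by
  have h7 : g ^ 3 ^ n = 1 := D.pown _
  have h8 : orderOf g ∣ Nat.gcd m (3 ^ n) :=
    Nat.dvd_gcd (orderOf_dvd_of_pow_eq_one h) (orderOf_dvd_of_pow_eq_one h7)
  have h9 : Nat.Coprime m (3 ^ n) :=
    (Nat.Coprime.pow_left n ((Nat.Prime.coprime_iff_not_dvd Nat.prime_three).2 hm)).symm
  rw [h9] at h8
  exact orderOf_eq_one_iff.1 (Nat.dvd_one.1 h8)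

lemma DCtx.inv_exp (D : DCtx G n z u) {m : ℕ} (hm : ¬ 3 ∣ m) :
    ∃ m1 : ℕ, ¬ 3 ∣ m1 ∧ ∀ g : G, g ^ (m * m1) = g := by
  refine ⟨m ^ ((Fintype.card G).totient - 1), fun h => hm (Nat.prime_three.dvd_of_dvd_pow h),
    fun g => ?_⟩
  have hpos : 0 < (Fintype.card G).totient := Nat.totient_pos.2 Fintype.card_pos
  rw [← pow_succ', Nat.sub_add_cancel hpos]
  have h2 := Nat.ModEq.pow_totient (D.coprime hm).symm
  have h3 : m ^ (Fintype.card G).totient ≡ 1 [MOD orderOf g] :=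
    h2.of_dvd (orderOf_dvd_card)
  have := (pow_eq_pow_iff_modEq (x := g)).2 h3
  simpa using this

/-- A nontrivial cube of order three lies in `C₁`. -/
lemma DCtx.cube_mem (D : DCtx G n z u) {w : G} (hw : (w ^ 3) ^ 3 = 1) :
    w ^ 3 ∈ Subgroup.zpowers z := by
  by_cases h : w ^ 3 = 1
  · rw [h]; exact one_mem _
  obtain ⟨t, ht⟩ := mem_powers_iff_mem_zpowers.2 (D.cube w h)
  change (w ^ 3) ^ t = z at ht
  have h3 : (w ^ 3) ^ t = (w ^ 3) ^ (t % 3) := by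
    conv_lhs => rw [← Nat.div_add_mod t 3, pow_add, pow_mul, hw, one_pow, one_mul]
  rw [h3] at ht
  have : t % 3 < 3 := Nat.mod_lt _ (by norm_num)
  have hz1 := D.z1
  interval_cases t % 3
  · rw [pow_zero] at ht; exact absurd ht.symm hz1
  · rw [pow_one] at ht; rw [ht]; exact Subgroup.mem_zpowers _
  · have : w ^ 3 = z ^ 2 := by
      rw [← ht, ← pow_mul, pow_succ (w ^ 3) 3, hw, one_mul]
    rw [this]; exact pow_mem (Subgroup.mem_zpowers _) _

lemma DCtx.pow_memC (D : DCtx G n z u) {k : ℕ} (hk : 1 ≤ k) {x : G} (hx : x ^ 3 ^ (k + 1) = 1) :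
    x ^ 3 ^ k ∈ Subgroup.zpowers z := by
  obtain ⟨k, rfl⟩ : ∃ l, k = l + 1 := ⟨k - 1, by omega⟩
  rw [pow_succ 3 k, pow_mul]
  apply D.cube_mem
  rw [← pow_mul, ← pow_mul, show 3 ^ k * (3 * 3) = 3 ^ (k + 1 + 1) by ring]
  exact hx

lemma DCtx.cpow (D : DCtx G n z u) {c : G} (hc : c ∈ Subgroup.zpowers z) {k : ℕ} (hk : 1 ≤ k) :
    c ^ 3 ^ k = 1 := by
  obtain ⟨k, rfl⟩ : ∃ l, k = l + 1 := ⟨k - 1, by omega⟩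
  rw [pow_succ', pow_mul, D.C3 hc, one_pow]

lemma pow_three_one {c : G} (hc : c ^ 3 = 1) {k : ℕ} (hk : 1 ≤ k) :
    c ^ 3 ^ k = 1 := by
  obtain ⟨k, rfl⟩ : ∃ l, k = l + 1 := ⟨k - 1, by omega⟩
  rw [pow_succ', pow_mul, hc, one_pow]

lemma DCtx.gen_C (D : DCtx G n z u) {c : G} (hc : c ∈ Subgroup.zpowers z) (hc1 : c ≠ 1) :
    z = c ∨ z = c * c := by
  rcases (D.memC c).1 hc with h | h | h
  · exact absurd h hc1
  · exact Or.inl h.symm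
  · right
    rw [h, ← pow_two, ← pow_mul, show 2 * 2 = 3 + 1 from rfl, pow_succ, D.z3, one_mul]

lemma free (hS : IsSRing S) (D : DCtx G n z u) {X : Finset G} (hX : X ∈ S) {k : ℕ} (hk : 1 ≤ k)
    (hmin : ∀ x ∈ X, x ^ 3 ^ k ≠ 1) (hrad : ∀ g : G, (∀ x ∈ X, g * x ∈ X) → g = 1)
    {x c : G} (hx : x ∈ X) (hxk : x ^ 3 ^ (k + 1) = 1) (hc : c ∈ Subgroup.zpowers z)
    (hxc : x * c ∈ X) : c = 1 := by
  by_contra hc1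
  have hzm := D.zmem hk (hmin x hx)
  obtain ⟨t, ht⟩ := mem_powers_iff_mem_zpowers.2 ((Subgroup.zpowers_le.2 hzm) hc)
  change (x ^ 3 ^ k) ^ t = c at ht
  have ht3 : ¬ 3 ∣ t := by
    rintro ⟨s, rfl⟩
    apply hc1
    rw [← ht, pow_mul, ← pow_mul x, ← pow_succ, hxk, one_pow]
  have h3 : 3 ∣ 3 ^ k * t := Dvd.dvd.mul_right (dvd_pow_self _ (by omega)) _
  have hmul : ∀ y ∈ X, y * (y ^ 3 ^ k) ^ t ∈ X := by
    intro y hy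
    have := pow_mem_basic hS (m := 1 + 3 ^ k * t) (by omega) (D.coprime (by omega)) hX hX hx
      (by rw [pow_add, pow_one, pow_mul, ht]; exact hxc) y hy
    rwa [pow_add, pow_one, pow_mul] at this
  apply D.z1
  apply hrad
  intro y hy
  rw [mul_comm]
  by_cases hyk : y ^ 3 ^ (k + 1) = 1
  · set c' := (y ^ 3 ^ k) ^ t with hc'
    have hc'C : c' ∈ Subgroup.zpowers z := pow_mem (D.pow_memC hk hyk) _
    have hc'1 : c' ≠ 1 := fun h => hmin y hy (D.pow_eq_one ht3 h)
    have h1 : y * c' ∈ X := hmul y hy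
    have h2 : y * (c' * c') ∈ X := by
      have := hmul _ h1
      rwa [mul_pow, D.cpow hc'C hk, mul_one, ← hc', mul_assoc] at this
    rcases D.gen_C hc'C hc'1 with h | h
    · rw [h]; exact h1
    · rw [h]; exact h2
  · exact zinv hS D hX (k := k + 1) (by omega) hx hxk hy hyk z (Subgroup.mem_zpowers z)

lemma lemF (hS : IsSRing S) (D : DCtx G n z u) {X : Finset G} (hX : X ∈ S) {k : ℕ} (hk : 1 ≤ k)
    (hmin : ∀ x ∈ X, x ^ 3 ^ k ≠ 1) (hrad : ∀ g : G, (∀ x ∈ X, g * x ∈ X) → g = 1)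
    {x : G} (hx : x ∈ X) (hxk : x ^ 3 ^ (k + 1) = 1) {m : ℕ} (hm : m % 3 = 1)
    (hxm : x ^ m ∈ X) : x ^ m = x := by
  by_contra hne
  have hcl : ∀ j : ℕ, x ^ m ^ j ∈ X := by
    intro j
    induction j with
    | zero => simpa using hx
    | succ j ih =>
      rw [pow_succ, pow_mul]
      exact pow_mem_basic hS (m := m) (by omega) (D.coprime (by omega)) hX hX hx hxm _ ih
  have hex : ∃ i : ℕ, x ^ m ^ 3 ^ i = x := by
    refine ⟨k, ?_⟩
    have h1 : ((3 : ℕ) : ℤ) ∣ (m : ℤ) - 1 := by omega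
    have h2 := dvd_sub_pow_of_dvd_sub h1 k
    rw [one_pow] at h2
    have h3 : (1 : ℕ) ≡ m ^ 3 ^ k [MOD 3 ^ (k + 1)] := by
      rw [Nat.modEq_iff_dvd]
      push_cast at h2 ⊢
      exact h2
    have h4 := h3.symm.of_dvd (orderOf_dvd_of_pow_eq_one hxk)
    simpa using (pow_eq_pow_iff_modEq (x := x)).2 h4
  set i := Nat.find hex with hi
  have hi1 : x ^ m ^ 3 ^ i = x := Nat.find_spec hex
  have hi0 : i ≠ 0 := by
    intro h0
    rw [h0] at hi1
    exact hne (by simpa using hi1)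
  have hi2 : x ^ m ^ 3 ^ (i - 1) ≠ x := Nat.find_min hex (by omega)
  set M := m ^ 3 ^ (i - 1) with hM
  have hM3 : M ^ 3 = m ^ 3 ^ i := by
    rw [hM, ← pow_mul, ← pow_succ, Nat.sub_add_cancel (by omega)]
  have hMmod : M % 3 = 1 := by
    have : M ≡ 1 ^ 3 ^ (i - 1) [MOD 3] := Nat.ModEq.pow _ hm
    rw [one_pow] at this
    exact this
  obtain ⟨a, ha⟩ : ∃ a, M = 3 * a + 1 := ⟨M / 3, by omega⟩
  have hxM : x ^ M = x * (x ^ a) ^ 3 := by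
    rw [ha, pow_succ, mul_comm 3 a, pow_mul, mul_comm]
  have hv3 : ((x ^ a) ^ 3) ^ 3 = 1 := by
    apply D.pow_eq_one (m := 1 + 3 * (a + a * a)) (by omega)
    rw [← hM3] at hi1
    have h5 : M ^ 3 = 1 + a * 3 * 3 * (1 + 3 * (a + a * a)) := by rw [ha]; ring
    rw [h5, pow_add, pow_one] at hi1
    have h6 := mul_eq_left.1 hi1
    rwa [pow_mul, pow_mul, pow_mul] at h6
  have hv := D.cube_mem hv3
  have h7 : x * (x ^ a) ^ 3 ∈ X := by rw [← hxM]; exact hcl _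
  have h8 := free hS D hX hk hmin hrad hx hxk hv h7
  exact hi2 (by rw [hxM, h8, mul_one])

lemma lemF' (hS : IsSRing S) (D : DCtx G n z u) {X : Finset G} (hX : X ∈ S) {k : ℕ} (hk : 1 ≤ k)
    (hmin : ∀ x ∈ X, x ^ 3 ^ k ≠ 1) (hrad : ∀ g : G, (∀ x ∈ X, g * x ∈ X) → g = 1)
    {x : G} (hx : x ∈ X) (hxk : x ^ 3 ^ (k + 1) = 1) {m : ℕ} (hm : ¬ 3 ∣ m)
    (hxm : x ^ m ∈ X) : x ^ m = x ∨ x ^ m = x⁻¹ := by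
  rcases (by omega : m % 3 = 1 ∨ m % 3 = 2) with h | h
  · exact Or.inl (lemF hS D hX hk hmin hrad hx hxk h hxm)
  · right
    have h2 : x ^ (m * m) ∈ X := by
      rw [pow_mul]
      exact pow_mem_basic hS (m := m) (by omega) (D.coprime (by omega)) hX hX hx hxm _ hxm
    have h3 := lemF hS D hX hk hmin hrad hx hxk (m := m * m) (by rw [Nat.mul_mod, h]) h2
    obtain ⟨a, rfl⟩ : ∃ a, m = a + 1 := ⟨m - 1, by omega⟩
    rw [eq_inv_iff_mul_eq_one, ← pow_succ]
    apply D.pow_eq_one (m := a) (by omega)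
    rw [show (a + 1) * (a + 1) = 1 + (a + 1 + 1) * a by ring, pow_add, pow_one, mul_eq_left,
      pow_mul] at h3
    exact h3

lemma DCtx.cls (D : DCtx G n z u) {k : ℕ} (hk : 1 ≤ k) {x g : G} (hx : x ^ 3 ^ (k + 1) = 1)
    (hx1 : x ^ 3 ^ k ≠ 1) (hg : g ^ 3 ^ (k + 1) = 1) (hg1 : g ^ 3 ^ k ≠ 1) :
    ∃ i m : ℕ, i < 3 ∧ ¬ 3 ∣ m ∧ x = (g * u ^ i) ^ m := by
  obtain ⟨t, ht⟩ := mem_powers_iff_mem_zpowers.2 (D.cyc k x g hx hg1)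
  change (g ^ 3) ^ t = x ^ 3 at ht
  have he : ((g ^ t)⁻¹ * x) ^ 3 = 1 := by
    rw [mul_pow, inv_pow, ← pow_mul, mul_comm t, pow_mul, ht, inv_mul_cancel]
  obtain ⟨j, hj, hjc⟩ := D.ecov _ he
  obtain ⟨s, hs⟩ := mem_powers_iff_mem_zpowers.2 ((Subgroup.zpowers_le.2 (D.zmem hk hg1)) hjc)
  change (g ^ 3 ^ k) ^ s = _ at hs
  have ht3 : ¬ 3 ∣ t := by
    rintro ⟨s, rfl⟩
    apply hx1
    obtain ⟨k, rfl⟩ : ∃ l, k = l + 1 := ⟨k - 1, by omega⟩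
    rw [pow_succ', pow_mul, ← ht, ← pow_mul, ← pow_mul,
      show 3 * (3 * s * 3 ^ k) = 3 ^ (k + 1 + 1) * s by ring, pow_mul, hg, one_pow]
  have h3 : 3 ∣ 3 ^ k * s := Dvd.dvd.mul_right (dvd_pow_self _ (by omega)) _
  set m := t + 3 ^ k * s with hm
  refine ⟨(2 * j * m) % 3, m, Nat.mod_lt _ (by norm_num), by omega, ?_⟩
  have hu : ∀ a b : ℕ, a % 3 = b % 3 → u ^ a = u ^ b := by
    intro a b hab
    exact (pow_eq_pow_iff_modEq (x := u)).2
      (Nat.ModEq.of_dvd (orderOf_dvd_of_pow_eq_one D.u3) hab)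
  have hx' : x = u ^ (2 * j) * g ^ m := by
    have h4 : u ^ (2 * j) * u ^ j = 1 := by
      rw [← pow_add, show 2 * j + j = 3 * j by ring, pow_mul, D.u3, one_pow]
    rw [hm, pow_add, pow_mul g, hs]
    calc x = 1 * (g ^ t * (g ^ t)⁻¹) * x := by simp
      _ = u ^ (2 * j) * u ^ j * (g ^ t * (g ^ t)⁻¹) * x := by rw [h4]
      _ = _ := by simp only [mul_assoc]; congr 1; rw [mul_left_comm]
  rw [hx', mul_pow, mul_comm]
  congr 1
  rw [← pow_mul]
  apply hu
  have hmm : (m * m) % 3 = 1 := by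
    rcases (by omega : m % 3 = 1 ∨ m % 3 = 2) with h | h <;> rw [Nat.mul_mod, h]
  rw [Nat.mul_mod ((2 * j * m) % 3), Nat.mod_mod, ← Nat.mul_mod, mul_assoc (2 * j), Nat.mul_mod (2 * j) (m * m), hmm, mul_one, Nat.mod_mod]

end Ctx

end SR

namespace SR

section Ctx

variable {G : Type*} [CommGroup G] [Fintype G] {S : Finset (Finset G)} {n : ℕ} {z u : G}

/-- A highest nonregular basic set with trivial radical, all of whose elements have
order at least `3 ^ (k + 1)`. -/
structure KCtx (S : Finset (Finset G)) (X : Finset G) (k : ℕ) : Prop where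
  hX : X ∈ S
  hk : 1 ≤ k
  hmin : ∀ x ∈ X, x ^ 3 ^ k ≠ 1
  hrad : ∀ g : G, (∀ x ∈ X, g * x ∈ X) → g = 1
  ex0 : ∃ x ∈ X, x ^ 3 ^ (k + 1) = 1
  ey0 : ∃ y ∈ X, y ^ 3 ^ (k + 1) ≠ 1

variable {X : Finset G} {k : ℕ}

lemma KCtx.classes (C : KCtx S X k) (hS : IsSRing S) (D : DCtx G n z u) {g : G}
    (hg : g ^ 3 ^ (k + 1) = 1) (hg1 : g ^ 3 ^ k ≠ 1) :
    ∃ f : G → ℕ, (∀ x ∈ X, x ^ 3 ^ (k + 1) = 1 → f x < 3 ∧ (f x = 0 → x ∈ Subgroup.zpowers g)) ∧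
      ∀ x ∈ X, x ^ 3 ^ (k + 1) = 1 → ∀ x' ∈ X, x' ^ 3 ^ (k + 1) = 1 → f x = f x' →
        x' = x ∨ x' = x⁻¹ := by
  have : ∀ x : G, ∃ i m : ℕ, (x ∈ X → x ^ 3 ^ (k + 1) = 1 →
      i < 3 ∧ ¬ 3 ∣ m ∧ x = (g * u ^ i) ^ m) := by
    intro x
    by_cases h : x ∈ X ∧ x ^ 3 ^ (k + 1) = 1
    · obtain ⟨i, m, h'⟩ := D.cls C.hk h.2 (C.hmin x h.1) hg hg1
      exact ⟨i, m, fun _ _ => h'⟩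
    · exact ⟨0, 0, fun h1 h2 => absurd ⟨h1, h2⟩ h⟩
  choose f m hf using this
  refine ⟨f, fun x hx hxk => ⟨(hf x hx hxk).1, fun h0 => ?_⟩, ?_⟩
  · have h := (hf x hx hxk).2.2
    rw [h0, pow_zero, mul_one] at h
    rw [h]
    exact pow_mem (Subgroup.mem_zpowers g) _
  · intro x hx hxk x' hx' hxk' hff
    obtain ⟨_, h1, h2⟩ := hf x hx hxk
    obtain ⟨_, h1', h2'⟩ := hf x' hx' hxk'
    obtain ⟨m1, hm1, hinv⟩ := D.inv_exp h1
    have h3 : x ^ m1 = g * u ^ f x := by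
      conv_lhs => rw [h2]
      rw [← pow_mul, hinv]
    have h4 : x' = x ^ (m1 * m x') := by
      rw [pow_mul, h3, hff]; exact h2'
    have h5 : ¬ 3 ∣ m1 * m x' := by
      intro h
      rcases (Nat.Prime.dvd_mul Nat.prime_three).1 h with h | h
      · exact hm1 h
      · exact h1' h
    rw [h4]
    exact lemF' hS D C.hX C.hk C.hmin C.hrad hx hxk h5 (by rw [← h4]; exact hx')

/-- The elements of the smallest order. -/
noncomputable def Xk (X : Finset G) (k : ℕ) : Finset G := X.filter (fun x => x ^ 3 ^ (k + 1) = 1)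

lemma mem_Xk {x : G} : x ∈ Xk X k ↔ x ∈ X ∧ x ^ 3 ^ (k + 1) = 1 := by simp [Xk]

lemma KCtx.card6 (C : KCtx S X k) (hS : IsSRing S) (D : DCtx G n z u) : (Xk X k).card ≤ 6 := by
  obtain ⟨x0, hx0, hx0k⟩ := C.ex0
  obtain ⟨f, hf1, hf2⟩ := C.classes hS D hx0k (C.hmin x0 hx0)
  have := Finset.card_le_mul_card_image_of_maps_to (s := Xk X k) (t := Finset.range 3) (f := f)
    (fun x hx => Finset.mem_range.2 (hf1 x (mem_Xk.1 hx).1 (mem_Xk.1 hx).2).1) 2 (by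
      intro i _
      rcases (Finset.eq_empty_or_nonempty ((Xk X k).filter (fun x => f x = i))) with h | ⟨x, hx⟩
      · rw [h]; simp
      · rw [Finset.mem_filter, mem_Xk] at hx
        have hsub : (Xk X k).filter (fun x => f x = i) ⊆ {x, x⁻¹} := by
          intro x' hx'
          rw [Finset.mem_filter, mem_Xk] at hx'
          have := hf2 x hx.1.1 hx.1.2 x' hx'.1.1 hx'.1.2 (hx.2.trans hx'.2.symm)
          simpa using this
        exact (Finset.card_le_card hsub).trans Finset.card_le_two)
  simpa using this

lemma DCtx.sq_mem (D : DCtx G n z u) {K : Subgroup G} {h : G} (h2 : h ^ 2 ∈ K) : h ∈ K := by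
  obtain ⟨m, _, hm⟩ := D.inv_exp (m := 2) (by omega)
  have := pow_mem h2 m
  rwa [← pow_mul, hm] at this

lemma KCtx.fib_inj {K : Subgroup G} (hK : ∀ x ∈ X, x ∉ K) (D : DCtx G n z u) {x x' a : G}
    (hx : x ∈ X) (hxa : x⁻¹ * a ∈ K) (hxa' : x'⁻¹ * a ∈ K) (h : x' = x ∨ x' = x⁻¹) : x = x' := by
  rcases h with h | h
  · exact h.symm
  · exfalso
    subst h
    apply hK x hx
    apply D.sq_mem
    have := mul_mem (inv_mem hxa) hxa'
    have e : (x⁻¹ * a)⁻¹ * (x⁻¹⁻¹ * a) = x ^ 2 := by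
      rw [mul_inv, inv_inv, mul_mul_mul_comm, inv_mul_cancel, mul_one, pow_two]
    rwa [e] at this

lemma KCtx.card3 (C : KCtx S X k) (hS : IsSRing S) (D : DCtx G n z u) {K : Subgroup G}
    (hK : ∀ x ∈ X, x ∉ K) (a : G) : (cos (Xk X k) K a).card ≤ 3 := by
  obtain ⟨x0, hx0, hx0k⟩ := C.ex0
  obtain ⟨f, hf1, hf2⟩ := C.classes hS D hx0k (C.hmin x0 hx0)
  have : (cos (Xk X k) K a).card ≤ (Finset.range 3).card := by
    refine Finset.card_le_card_of_injOn f ?_ ?_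
    · intro x hx
      have hx : x ∈ cos (Xk X k) K a := hx
      rw [mem_cos, mem_Xk] at hx
      simpa using (hf1 x hx.1.1 hx.1.2).1
    · intro x hx x' hx' hff
      have hx : x ∈ cos (Xk X k) K a := hx
      have hx' : x' ∈ cos (Xk X k) K a := hx'
      rw [mem_cos, mem_Xk] at hx hx'
      exact KCtx.fib_inj hK D hx.1.1 hx.2 hx'.2 (hf2 x hx.1.1 hx.1.2 x' hx'.1.1 hx'.1.2 hff)
  simpa using this

lemma KCtx.card2 (C : KCtx S X k) (hS : IsSRing S) (D : DCtx G n z u) {K : Subgroup G}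
    (hK : ∀ x ∈ X, x ∉ K) {g : G} (hgK : g ∈ K) (hg : g ^ 3 ^ (k + 1) = 1) (hg1 : g ^ 3 ^ k ≠ 1)
    (a : G) : (cos (Xk X k) K a).card ≤ 2 := by
  obtain ⟨f, hf1, hf2⟩ := C.classes hS D hg hg1
  have : (cos (Xk X k) K a).card ≤ ({1, 2} : Finset ℕ).card := by
    refine Finset.card_le_card_of_injOn f ?_ ?_
    · intro x hx
      have hx : x ∈ cos (Xk X k) K a := hx
      rw [mem_cos, mem_Xk] at hx
      obtain ⟨h1, h2⟩ := hf1 x hx.1.1 hx.1.2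
      have h0 : f x ≠ 0 := fun h0 => hK x hx.1.1 ((Subgroup.zpowers_le.2 hgK) (h2 h0))
      simp only [Finset.coe_insert, Finset.coe_singleton, Set.mem_insert_iff, Set.mem_singleton_iff]
      omega
    · intro x hx x' hx' hff
      have hx : x ∈ cos (Xk X k) K a := hx
      have hx' : x' ∈ cos (Xk X k) K a := hx'
      rw [mem_cos, mem_Xk] at hx hx'
      exact KCtx.fib_inj hK D hx.1.1 hx.2 hx'.2 (hf2 x hx.1.1 hx.1.2 x' hx'.1.1 hx'.1.2 hff)
  simpa using this

lemma KCtx.zinv (C : KCtx S X k) (hS : IsSRing S) (D : DCtx G n z u) {y : G} (hy : y ∈ X)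
    (hyk : y ^ 3 ^ (k + 1) ≠ 1) : ∀ c ∈ Subgroup.zpowers z, y * c ∈ X := by
  obtain ⟨x0, hx0, hx0k⟩ := C.ex0
  exact SR.zinv hS D C.hX (k := k + 1) (by omega) hx0 hx0k hy hyk

lemma KCtx.dif_eq (C : KCtx S X k) (hS : IsSRing S) (D : DCtx G n z u) : dif X z = Xk X k := by
  ext x
  rw [mem_dif, mem_Xk]
  constructor
  · rintro ⟨h1, h2⟩
    refine ⟨h1, ?_⟩
    by_contra h
    exact h2 (by rw [mul_comm]; exact C.zinv hS D h1 h _ (inv_mem (Subgroup.mem_zpowers z)))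
  · rintro ⟨h1, h2⟩
    refine ⟨h1, fun h => D.z1 ?_⟩
    rw [mul_comm] at h
    exact inv_eq_one.1 (free hS D C.hX C.hk C.hmin C.hrad h1 h2 (inv_mem (Subgroup.mem_zpowers z)) h)

lemma KCtx.lam_z (C : KCtx S X k) (hS : IsSRing S) (D : DCtx G n z u) :
    lam X z = (X \ Xk X k).card := by
  have h1 := dif_add X z
  rw [C.dif_eq hS D] at h1
  have h2 : (X \ Xk X k).card + (Xk X k).card = X.card :=
    Finset.card_sdiff_add_card_eq_card (Finset.filter_subset _ _)
  omega

lemma mem_Xg {x : G} : x ∈ X \ Xk X k ↔ x ∈ X ∧ x ^ 3 ^ (k + 1) ≠ 1 := by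
  rw [Finset.mem_sdiff, mem_Xk]; tauto

lemma KCtx.Xg3 (C : KCtx S X k) (hS : IsSRing S) (D : DCtx G n z u) :
    3 ≤ (X \ Xk X k).card := by
  obtain ⟨y, hy, hyk⟩ := C.ey0
  refine coset_three D (y := y) (fun c hc => mem_Xg.2 ⟨C.zinv hS D hy hyk c hc, ?_⟩)
  rwa [mul_pow, D.cpow hc (by omega), mul_one]

end Ctx

end SR

namespace SR

section Ctx

variable {G : Type*} [CommGroup G] [Fintype G] {S : Finset (Finset G)} {n : ℕ} {z u : G}
variable {X : Finset G} {k : ℕ}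

lemma inj3 {q : G} (h1 : q ≠ 1) (h2 : q ^ 2 ≠ 1) {i j : ℕ} (hi : i < 3) (hj : j < 3)
    (h : q ^ i = q ^ j) : i = j := by
  have h3 : q ≠ q ^ 2 := by
    intro h
    rw [pow_two] at h
    exact h1 (mul_eq_left.1 h.symm)
  interval_cases i <;> interval_cases j <;> simp_all

lemma KCtx.cosE (C : KCtx S X k) (hS : IsSRing S) (D : DCtx G n z u)
    (hE : IsU S (subgroupFinset (E3 G))) {y : G} (hy : y ∈ X) : (cos X (E3 G) y).card ≤ 3 := by
  obtain ⟨x0, hx0, hx0k⟩ := C.ex0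
  rw [cos_card hS C.hX hE hy hx0]
  have : ∀ x : G, ∃ i : ℕ, i < 3 ∧ ((x0⁻¹ * x) ^ 3 = 1 → u ^ i * (x0⁻¹ * x) ∈ Subgroup.zpowers z) := by
    intro x
    by_cases h : (x0⁻¹ * x) ^ 3 = 1
    · obtain ⟨i, hi, h'⟩ := D.ecov _ h
      exact ⟨i, hi, fun _ => h'⟩
    · exact ⟨0, by norm_num, fun h' => absurd h' h⟩
  choose f hf1 hf2 using this
  have h1 : (cos X (E3 G) x0).card ≤ (Finset.range 3).card := by
    refine Finset.card_le_card_of_injOn f (fun x _ => by simpa using hf1 x) ?_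
    intro x hx y hy hxy
    have hx : x ∈ cos X (E3 G) x0 := hx
    have hy : y ∈ cos X (E3 G) x0 := hy
    rw [mem_cos] at hx hy
    have e1 := hf2 x (mem_E3.1 (inv_mul_mem_comm.1 hx.2))
    have e2 := hf2 y (mem_E3.1 (inv_mul_mem_comm.1 hy.2))
    rw [← hxy] at e2
    have e3 := mul_mem (inv_mem e1) e2
    have e4 : (u ^ f x * (x0⁻¹ * x))⁻¹ * (u ^ f x * (x0⁻¹ * y)) = x⁻¹ * y := by
      simp only [mul_inv, inv_inv]
      have : (u ^ f x)⁻¹ * (x0 * x⁻¹) * (u ^ f x * (x0⁻¹ * y)) =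
        ((u ^ f x)⁻¹ * u ^ f x) * (x0 * x0⁻¹) * (x⁻¹ * y) := by
          simp only [mul_assoc, mul_comm, mul_left_comm]
      rw [this]; simp
    rw [e4] at e3
    have hxk : x ^ 3 ^ (k + 1) = 1 := by
      have h := pow_three_one (mem_E3.1 hx.2) (k := k + 1) (by omega)
      rw [mul_pow, hx0k, mul_one, inv_pow, inv_eq_one] at h
      exact h
    have := free hS D C.hX C.hk C.hmin C.hrad hx.1 hxk e3 (by simpa using hy.1)
    exact inv_mul_eq_one.1 this
  simpa using h1

lemma KCtx.nine (C : KCtx S X k) (hS : IsSRing S) (D : DCtx G n z u)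
    (hE : IsU S (subgroupFinset (E3 G))) : 9 ≤ (X \ Xk X k).card := by
  obtain ⟨x0, hx0, hx0k⟩ := C.ex0
  obtain ⟨y0, hy0, hy0k⟩ := C.ey0
  have h3 : ∀ t, ¬ 3 ∣ 1 + 3 ^ k * t := by
    intro t h
    have : 3 ∣ 3 ^ k * t := Dvd.dvd.mul_right (dvd_pow_self 3 (by have := C.hk; omega)) t
    omega
  have key : ∀ t : ℕ, ∃ a ∈ X, ∃ e ∈ subgroupFinset (E3 G), y0 ^ (1 + 3 ^ k * t) = a * e := by
    intro t
    obtain ⟨Y, hY, hxY⟩ := hS.cover (x0 ^ (1 + 3 ^ k * t))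
    have hyY := pow_mem_basic hS (m := 1 + 3 ^ k * t) (by omega) (D.coprime (h3 t)) C.hX hY hx0 hxY y0 hy0
    refine mul_isU hS (isU_of_mem hS C.hX) hE hY (a := x0) (b := (x0 ^ 3 ^ k) ^ t) hx0 ?_ ?_ hyY
    · rw [mem_sf, mem_E3, ← pow_mul, mul_comm t 3, pow_mul, ← pow_mul x0, ← pow_succ, hx0k, one_pow]
    · rwa [pow_add, pow_one, pow_mul] at hxY
  choose a ha e he heq using key
  have heE : ∀ t, e t ^ 3 = 1 := fun t => mem_E3.1 (mem_sf.1 (he t))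
  have hak : ∀ t, a t ^ 3 ^ (k + 1) ≠ 1 := by
    intro t h
    have h' := congrArg (· ^ 3 ^ (k + 1)) (heq t)
    simp only [mul_pow, h, pow_three_one (heE t) (k := k + 1) (by omega), mul_one] at h'
    rw [← pow_mul, mul_comm, pow_mul] at h'
    exact hy0k (D.pow_eq_one (h3 t) h')
  have hcard : ((Finset.range 3) ×ˢ (Finset.range 3)).card ≤ (X \ Xk X k).card := by
    refine Finset.card_le_card_of_injOn (fun p => a p.1 * z ^ p.2) ?_ ?_
    · rintro ⟨t, j⟩ _
      have hz : z ^ j ∈ Subgroup.zpowers z := pow_mem (Subgroup.mem_zpowers z) j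
      simp only [Finset.mem_coe]
      rw [mem_Xg]
      refine ⟨C.zinv hS D (ha t) (hak t) _ hz, ?_⟩
      rw [mul_pow, D.cpow hz (by omega), mul_one]
      exact hak t
    · rintro ⟨t, j⟩ h1 ⟨t', j'⟩ h2 h
      simp only [Finset.coe_product, Set.mem_prod, Finset.mem_coe, Finset.mem_range] at h1 h2
      simp only at h
      have hq : (y0 ^ 3 ^ (k + 1)) ^ t = (y0 ^ 3 ^ (k + 1)) ^ t' := by
        have hc : ∀ j, (z ^ j) ^ 3 = 1 := fun j => D.C3 (pow_mem (Subgroup.mem_zpowers z) j)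
        have ha3 : a t ^ 3 = a t' ^ 3 := by
          have := congrArg (· ^ 3) h
          simpa only [mul_pow _ _ 3, hc, mul_one] using this
        have hy3 : ∀ t, y0 ^ 3 * (y0 ^ 3 ^ (k + 1)) ^ t = a t ^ 3 := by
          intro t
          have := congrArg (· ^ 3) (heq t)
          simp only [mul_pow _ _ 3, heE, mul_one] at this
          rw [← this, ← pow_mul, ← pow_mul, ← pow_add]
          congr 1; ring
        have := (hy3 t).trans (ha3.trans (hy3 t').symm)
        exact mul_left_cancel this
      have ht : t = t' := inj3 hy0k (fun h => hy0k (D.pow_eq_one (m := 2) (by omega) h)) h1.1 h2.1 hq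
      subst ht
      have hj : j = j' := inj3 D.z1 D.z2 h1.2 h2.2 (mul_left_cancel h)
      rw [hj]
  simpa using hcard

lemma KCtx.case1 (C : KCtx S X k) (hS : IsSRing S) (D : DCtx G n z u) {W : Finset G}
    (hW : W ∈ S) (hz : z ∈ W) (hWE : ∀ w ∈ W, w ^ 3 = 1) : False := by
  obtain ⟨y0, hy0, hy0k⟩ := C.ey0
  obtain ⟨hE, w, hw, hwC⟩ := E_sub hS D hW hz hWE C.hX hy0 (C.zinv hS D hy0 hy0k) C.hrad
  have h1 : lam X w ≤ (Xk X k).card := by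
    apply Finset.card_le_card
    intro y hy
    rw [Finset.mem_filter] at hy
    by_contra hyk
    have hyk : y ^ 3 ^ (k + 1) ≠ 1 := fun h => hyk (mem_Xk.2 ⟨hy.1, h⟩)
    have hc := C.zinv hS D hy.1 hyk
    have hm : ∀ c ∈ Subgroup.zpowers z, y * c ∈ cos X (E3 G) y := by
      intro c hcz
      rw [mem_cos]
      refine ⟨hc c hcz, ?_⟩
      rw [mul_inv, mul_comm y⁻¹, mul_assoc, inv_mul_cancel, mul_one, mem_E3]
      exact D.C3 (inv_mem hcz)
    have hwm : w⁻¹ * y ∈ cos X (E3 G) y := by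
      rw [mem_cos]
      refine ⟨hy.2, ?_⟩
      rw [mul_inv, inv_inv, mul_assoc, inv_mul_cancel, mul_one, mem_E3]
      exact hWE w hw
    have hzz : ∀ j : ℕ, z ^ j ∈ Subgroup.zpowers z := fun j => pow_mem (Subgroup.mem_zpowers z) j
    have hne : ∀ c ∈ Subgroup.zpowers z, y * c ≠ w⁻¹ * y := by
      intro c hcz h
      rw [mul_comm] at h
      have := mul_right_cancel h
      rw [this] at hcz
      exact hwC (by simpa using inv_mem hcz)
    have h0 := hm (z ^ 0) (hzz 0)
    have h1 := hm (z ^ 1) (hzz 1)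
    have h2 := hm (z ^ 2) (hzz 2)
    refine four_contra (C.cosE hS D hE hy.1) h0 h1 h2 hwm ?_ ?_ (hne _ (hzz 0)) ?_ (hne _ (hzz 1)) (hne _ (hzz 2))
    · intro h; have := inj3 D.z1 D.z2 (by norm_num) (by norm_num) (mul_left_cancel h); omega
    · intro h; have := inj3 D.z1 D.z2 (by norm_num) (by norm_num) (mul_left_cancel h); omega
    · intro h; have := inj3 D.z1 D.z2 (by norm_num) (by norm_num) (mul_left_cancel h); omega
  rw [lam_eq hS (isU_of_mem hS C.hX) hW hw hz, C.lam_z hS D] at h1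
  have := C.card6 hS D
  have := C.nine hS D hE
  omega

end Ctx

end SR

namespace SR

section Ctx

variable {G : Type*} [CommGroup G] [Fintype G] {S : Finset (Finset G)} {n : ℕ} {z u : G}
variable {X : Finset G} {k : ℕ}

lemma W7 (hS : IsSRing S) (D : DCtx G n z u) {W : Finset G} (hW : W ∈ S) (hz : z ∈ W)
    {y : G} (hy : y ∈ W) (hy3 : y ^ 3 ≠ 1) : 7 ≤ W.card := by
  have hyi : y⁻¹ ∈ W := (inv_mem_of hS hW hW hz (thmA_sym hS D hW hz hy hy3) y).1 hy
  have hyi3 : y⁻¹ ^ 3 ≠ 1 := by rwa [inv_pow, ne_eq, inv_eq_one]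
  have hyC : y ∉ Subgroup.zpowers z := fun h => hy3 (D.C3 h)
  have hzc := Subgroup.mem_zpowers z
  have h1 : 3 ≤ (W.filter (fun x => y⁻¹ * x ∈ Subgroup.zpowers z)).card := by
    refine coset_three D (y := y) ?_
    intro c hc
    rw [Finset.mem_filter]
    refine ⟨zinv hS D hW (k := 1) le_rfl hz (by simpa using D.z3) hy (by simpa using hy3) c hc, ?_⟩
    simpa using hc
  have h2 : 3 ≤ (W.filter (fun x => y * x ∈ Subgroup.zpowers z)).card := by
    refine coset_three D (y := y⁻¹) ?_
    intro c hc
    rw [Finset.mem_filter]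
    refine ⟨zinv hS D hW (k := 1) le_rfl hz (by simpa using D.z3) hyi (by simpa using hyi3) c hc, ?_⟩
    simpa using hc
  have hd : Disjoint (W.filter (fun x => y⁻¹ * x ∈ Subgroup.zpowers z))
      (W.filter (fun x => y * x ∈ Subgroup.zpowers z)) := by
    rw [Finset.disjoint_left]
    intro x hx hx'
    rw [Finset.mem_filter] at hx hx'
    apply hyC
    apply D.sq_mem
    have := mul_mem hx'.2 (inv_mem hx.2)
    have e : y * x * (y⁻¹ * x)⁻¹ = y ^ 2 := by
      rw [mul_inv, inv_inv, mul_mul_mul_comm, mul_inv_cancel, mul_one, pow_two]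
    rwa [e] at this
  have hzn : z ∉ (W.filter (fun x => y⁻¹ * x ∈ Subgroup.zpowers z)) ∪
      (W.filter (fun x => y * x ∈ Subgroup.zpowers z)) := by
    rw [Finset.mem_union, Finset.mem_filter, Finset.mem_filter]
    rintro (⟨_, h⟩ | ⟨_, h⟩)
    · rw [Subgroup.mul_mem_cancel_right _ hzc] at h
      exact hyC (by simpa using inv_mem h)
    · rw [Subgroup.mul_mem_cancel_right _ hzc] at h
      exact hyC h
  have hsub : insert z ((W.filter (fun x => y⁻¹ * x ∈ Subgroup.zpowers z)) ∪
      (W.filter (fun x => y * x ∈ Subgroup.zpowers z))) ⊆ W := by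
    intro x hx
    rw [Finset.mem_insert, Finset.mem_union, Finset.mem_filter, Finset.mem_filter] at hx
    rcases hx with rfl | h | h
    exacts [hz, h.1, h.1]
  have := Finset.card_le_card hsub
  rw [Finset.card_insert_of_notMem hzn, Finset.card_union_of_disjoint hd] at this
  omega

lemma arith1 {a b r w x : ℕ} (hr : r ≤ 3) (ha : a ≤ 6) (hb : 3 ≤ b) (hw : 7 ≤ w) (hx : x = a + b)
    (h : x + w * b ≤ x * r) : False := by
  have h1 : x * r ≤ x * 3 := Nat.mul_le_mul_left _ hr
  have h2 : 7 * b ≤ w * b := Nat.mul_le_mul_right _ hw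
  omega

lemma arith2 {r κ : ℕ} (hr : 3 ≤ r) (hk : r + 3 ≤ κ) (h8 : 8 ≤ κ) (h : r * κ + 2 ≤ 2 * κ + r * r) :
    False := by
  obtain ⟨s, rfl⟩ := Nat.exists_eq_add_of_le hr
  obtain ⟨t, rfl⟩ := Nat.exists_eq_add_of_le hk
  rcases s with _ | _ | s
  · omega
  · omega
  · nlinarith [Nat.zero_le (s * t)]

lemma DCtx.exact_pow (D : DCtx G n z u) {g : G} (hg : g ^ 3 ^ k ≠ 1) :
    ∃ j : ℕ, (g ^ j) ^ 3 ^ (k + 1) = 1 ∧ (g ^ j) ^ 3 ^ k ≠ 1 := by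
  have hex : ∃ j, g ^ 3 ^ j = 1 := ⟨n, D.pown g⟩
  have h1 := Nat.find_spec hex
  have hk : k < Nat.find hex := by
    by_contra h
    rw [not_lt] at h
    apply hg
    obtain ⟨d, hd⟩ := Nat.exists_eq_add_of_le h
    rw [hd, pow_add, pow_mul, h1, one_pow]
  have h2 := Nat.find_min hex (m := Nat.find hex - 1) (by omega)
  refine ⟨3 ^ (Nat.find hex - (k + 1)), ?_, ?_⟩
  · rw [← pow_mul, ← pow_add, show Nat.find hex - (k + 1) + (k + 1) = Nat.find hex by omega]
    exact h1
  · rw [← pow_mul, ← pow_add, show Nat.find hex - (k + 1) + k = Nat.find hex - 1 by omega]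
    exact h2

lemma KCtx.false (C : KCtx S X k) (hS : IsSRing S) (D : DCtx G n z u) : False := by
  obtain ⟨W, hW, hz⟩ := hS.cover z
  by_cases hWE : ∀ w ∈ W, w ^ 3 = 1
  · exact C.case1 hS D hW hz hWE
  push Not at hWE
  obtain ⟨y, hy, hy3⟩ := hWE
  obtain ⟨x0, hx0, hx0k⟩ := C.ex0
  obtain ⟨y0, hy0, hy0k⟩ := C.ey0
  obtain ⟨K, hK, hab⟩ := thmA hS D hW hz hy hy3
  have hk := C.hk
  have h1W := one_notMem hS hW hz D.z1
  have h7 := W7 hS D hW hz hy hy3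
  have hWK : ∀ g ∈ W, g ∈ K := by
    intro g hg
    rcases hab with ⟨_, h⟩ | ⟨_, v, _, h⟩
    exacts [((h g).1 hg).1, ((h g).1 hg).1]
  have hXK : ∀ x ∈ X, x ∉ K := by
    intro x hx hxK
    have hy0K : y0 ∈ K := mem_sf.1 (hK X C.hX x hx (mem_sf.2 hxK) hy0)
    have hy0W : y0 ∈ W := by
      rcases hab with ⟨_, h⟩ | ⟨_, v, hv, h⟩
      · exact (h y0).2 ⟨hy0K, fun h => hy0k (by rw [h, one_pow])⟩
      · refine (h y0).2 ⟨hy0K, fun h => ?_⟩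
        obtain ⟨j, rfl⟩ := Subgroup.mem_zpowers_iff.1 h
        apply hy0k
        apply pow_three_one _ (by omega)
        rw [← zpow_natCast, ← zpow_mul, mul_comm, zpow_mul, zpow_natCast, hv, one_zpow]
    have hXW := eq_of_mem hS C.hX hW hy0 hy0W
    rw [← hXW] at hz
    exact C.hmin z hz (D.cpow (Subgroup.mem_zpowers z) hk)
  have hsub : insert 1 W ⊆ subgroupFinset K := by
    intro g hg
    rw [mem_sf]
    rcases Finset.mem_insert.1 hg with rfl | h
    exacts [one_mem _, hWK g h]
  by_cases hKk : ∀ g ∈ K, g ^ 3 ^ k = 1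
  · have hr : (cos X K x0).card ≤ 3 := by
      refine le_trans (Finset.card_le_card ?_) (C.card3 hS D hXK x0)
      intro x hx
      rw [mem_cos] at hx
      rw [mem_cos, mem_Xk]
      refine ⟨⟨hx.1, ?_⟩, hx.2⟩
      have h := hKk _ hx.2
      have h' : (x⁻¹ * x0) ^ 3 ^ (k + 1) = 1 := by rw [pow_succ, pow_mul, h, one_pow]
      rw [mul_pow, hx0k, mul_one, inv_pow, inv_eq_one] at h'
      exact h'
    have hs := sum_lam_sub hS C.hX hK hx0
    have hle : ∑ g ∈ insert 1 W, lam X g ≤ ∑ g ∈ subgroupFinset K, lam X g :=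
      Finset.sum_le_sum_of_subset hsub
    rw [Finset.sum_insert h1W, lam_one, Finset.sum_congr rfl
      (fun g hg => lam_eq hS (isU_of_mem hS C.hX) hW hg hz), Finset.sum_const, smul_eq_mul,
      C.lam_z hS D, hs] at hle
    refine arith1 hr (C.card6 hS D) (C.Xg3 hS D) h7 ?_ hle
    have := Finset.card_sdiff_add_card_eq_card (s := Xk X k) (t := X) (by
      intro x hx; exact (mem_Xk.1 hx).1)
    omega
  · push Not at hKk
    obtain ⟨g, hgK, hg⟩ := hKk
    obtain ⟨t, ht⟩ := Subgroup.mem_zpowers_iff.1 (D.cyc k x0 g hx0k hg)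
    have heE : (x0 * g ^ (-t)) ^ 3 = 1 := by
      rw [mul_pow, ← ht, zpow_neg, inv_pow, ← zpow_natCast (g ^ t), ← zpow_mul, mul_comm t, zpow_mul,
        zpow_natCast, mul_inv_cancel]
    rcases hab with ⟨hKE, hKW⟩ | ⟨hEK, _⟩
    · obtain ⟨j, hj1, hj2⟩ := D.exact_pow hg
      have hC := lemC hS hW hz C.hX hK hKW hx0 (t := 2) (by
        intro x _
        rw [C.dif_eq hS D]
        exact C.card2 hS D hXK (pow_mem hgK j) hj1 hj2 x)
      have hCK : ∀ c ∈ Subgroup.zpowers z, c ∈ K := fun c hc => (Subgroup.zpowers_le.2 (hWK z hz)) hc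
      have hr : 3 ≤ (cos X K x0).card := by
        rw [cos_card hS C.hX hK hx0 hy0]
        refine coset_three D (y := y0) ?_
        intro c hc
        rw [mem_cos]
        refine ⟨C.zinv hS D hy0 hy0k c hc, ?_⟩
        rw [mul_inv, mul_comm y0⁻¹, mul_assoc, inv_mul_cancel, mul_one]
        exact inv_mem (hCK c hc)
      have hr' : 3 ≤ (cos Xᶜ K x0).card := by
        refine coset_three D (y := x0 * g ^ (-t)) ?_
        intro c hc
        rw [mem_cos, Finset.mem_compl]
        constructor
        · intro h
          apply C.hmin _ h
          rw [mul_pow, pow_three_one heE hk, D.cpow hc hk, one_mul]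
        · rw [mul_assoc, mul_inv, mul_comm x0⁻¹, mul_assoc, inv_mul_cancel, mul_one]
          exact inv_mem (mul_mem (zpow_mem hgK _) (hCK c hc))
      have hcc := cos_compl X K x0
      have h8 := Finset.card_le_card hsub
      rw [Finset.card_insert_of_notMem h1W] at h8
      exact arith2 hr (by omega) (by omega) hC
    · have := mul_mem (hEK _ heE) (zpow_mem hgK t)
      rw [mul_assoc, ← zpow_add, neg_add_cancel, zpow_zero, mul_one] at this
      exact hXK x0 hx0 this

end Ctx

end SR

namespace SR

section Ctx

variable {G : Type*} [CommGroup G] [Fintype G] {S : Finset (Finset G)} {n : ℕ} {z u : G}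

/-- The conclusion of the theorem in membership form. -/
def Concl (S : Finset (Finset G)) : Prop :=
  ∃ H L : Subgroup G, IsU S (subgroupFinset H) ∧ IsU S (subgroupFinset L) ∧
    H ⊓ L = ⊥ ∧ H ⊔ L = ⊤ ∧ Nat.card L ≤ 3 ∧ 3 ≤ Nat.card H ∧
    (∀ X ∈ S, (∀ x ∈ X, x ∈ H) → X = {1} ∨ ∀ g, g ∈ X ↔ g ∈ H ∧ g ≠ 1) ∧
    (∀ X ∈ S, ∃ X₁ ∈ S, ∃ X₂ ∈ S, (∀ x ∈ X₁, x ∈ H) ∧ (∀ x ∈ X₂, x ∈ L) ∧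
      ∀ g, g ∈ X ↔ ∃ a ∈ X₁, ∃ b ∈ X₂, a * b = g)

lemma card_ge_three (D : DCtx G n z u) {K : Subgroup G} (hz : z ∈ K) : 3 ≤ Nat.card K := by
  have h := Subgroup.orderOf_dvd_natCard K hz
  rw [orderOf_eq_prime D.z3 D.z1] at h
  exact Nat.le_of_dvd Nat.card_pos h

lemma concl_top (hS : IsSRing S) (D : DCtx G n z u) {W : Finset G} (hW : W ∈ S)
    (h : ∀ g, g ∈ W ↔ g ≠ 1) : Concl S := by
  have hcase : ∀ X ∈ S, X = {1} ∨ X = W := by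
    intro X hX
    obtain ⟨x, hx⟩ := hS.nonempty X hX
    by_cases h1 : x = 1
    · exact Or.inl (eq_of_mem hS hX hS.one_mem hx (by simp [h1]))
    · exact Or.inr (eq_of_mem hS hX hW hx ((h x).2 h1))
  refine ⟨⊤, ⊥, ?_, ?_, by simp, by simp, by simp, card_ge_three D (Subgroup.mem_top z), ?_, ?_⟩
  · intro X _ g _ _ x _
    simp [mem_sf]
  · intro X hX g hg hg1
    rw [mem_sf, Subgroup.mem_bot] at hg1
    have := eq_of_mem hS hX hS.one_mem hg (by simp [hg1])
    rw [this]
    intro x hx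
    rw [Finset.mem_singleton] at hx
    simp [mem_sf, hx]
  · intro X hX _
    rcases hcase X hX with h1 | h1
    · exact Or.inl h1
    · right
      intro g
      simp [h1, h]
  · intro X hX
    exact ⟨X, hX, {1}, hS.one_mem, by simp, by simp, by simp⟩

lemma cover_E (D : DCtx G n z u) {K : Subgroup G} {y0 : G} (hy0 : y0 ∈ K)
    (hy0h : y0 ^ 3 ^ (n - 1) ≠ 1) (hn : 2 ≤ n) (g : G) : ∃ e : G, e ^ 3 = 1 ∧ e⁻¹ * g ∈ K := by
  obtain ⟨t, ht⟩ := Subgroup.mem_zpowers_iff.1 (D.cyc (n - 1) g y0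
    (by rw [show n - 1 + 1 = n by omega]; exact D.pown g) hy0h)
  refine ⟨g * y0 ^ (-t), ?_, ?_⟩
  · rw [mul_pow, ← ht, zpow_neg, inv_pow, ← zpow_natCast (y0 ^ t), ← zpow_mul, mul_comm t, zpow_mul,
        zpow_natCast, mul_inv_cancel]
  · rw [mul_inv, zpow_neg, inv_inv, mul_comm g⁻¹, mul_assoc, inv_mul_cancel, mul_one]
    exact zpow_mem hy0 t

lemma high_cube (hn : 2 ≤ n) {y : G} (h : y ^ 3 ^ (n - 1) ≠ 1) : y ^ 3 ≠ 1 :=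
  fun h3 => h (pow_three_one h3 (by omega))

lemma zclosed (hS : IsSRing S) (D : DCtx G n z u) {X : Finset G} (hX : X ∈ S) {x0 m : G}
    (hx0 : x0 ∈ X) (hx03 : x0 ^ 3 = 1) (hm : m * z ∈ X) (hm3 : m ^ 3 ≠ 1) : m ∈ X := by
  have := zinv hS D hX (k := 1) le_rfl hx0 (by simpa using hx03) hm
    (by simpa [mul_pow, D.z3] using hm3) z⁻¹ (inv_mem (Subgroup.mem_zpowers z))
  simpa using this

/-- There is an element of order 3 outside `K` with non-highest basic set. -/
lemma exists_low (hS : IsSRing S) (D : DCtx G n z u) (hn : 2 ≤ n)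
    (hrad : ∀ X ∈ S, (∃ x ∈ X, x ^ 3 ^ (n - 1) ≠ 1) → ∀ g : G, (∀ x ∈ X, g * x ∈ X) → g = 1)
    {W : Finset G} (hW : W ∈ S) (hz : z ∈ W) {K : Subgroup G} (hK : IsU S (subgroupFinset K))
    (hKE : ∀ g ∈ K, g ^ 3 = 1 → g ∈ Subgroup.zpowers z) (hKW : ∀ g, g ∈ W ↔ g ∈ K ∧ g ≠ 1) :
    ∃ l : G, l ^ 3 = 1 ∧ l ∉ K ∧ ∃ U ∈ S, l ∈ U ∧ ∀ x ∈ U, x ^ 3 ^ (n - 1) = 1 := by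
  have huK : u ∉ K := fun h => D.uz (hKE u h D.u3)
  have hzK : z ∈ K := ((hKW z).1 hz).1
  obtain ⟨U, hU, huU⟩ := hS.cover u
  by_cases hh : ∃ y ∈ U, y ^ 3 ^ (n - 1) ≠ 1
  swap
  · push Not at hh
    exact ⟨u, D.u3, huK, U, hU, huU, hh⟩
  obtain ⟨y, hy, hyh⟩ := hh
  obtain ⟨m, hm1, hm2, hm3⟩ := lemJ hS D hW hz hU hK hKW hKE huU D.u3 hy (high_cube hn hyh)
    (hrad U hU ⟨y, hy, hyh⟩) huU
  have hmK : m ∉ K := by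
    intro h
    rw [Subgroup.mul_mem_cancel_right _ h] at hm1
    exact huK (by simpa using inv_mem hm1)
  have hmE : m ^ 3 = 1 := by
    by_contra h3
    have hnot : m * z ∉ U := fun h => hm2 (zclosed hS D hU huU D.u3 h h3)
    have := hm3 (m * z) (by rw [← mul_assoc]; exact mul_mem hm1 hzK) hnot
    exact D.z1 (mul_eq_left.1 this)
  obtain ⟨U', hU', hmU'⟩ := hS.cover m
  refine ⟨m, hmE, hmK, U', hU', hmU', ?_⟩
  by_contra hh
  push Not at hh
  obtain ⟨y', hy', hyh'⟩ := hh
  obtain ⟨m', hm1', hm2', hm3'⟩ := lemJ hS D hW hz hU' hK hKW hKE hmU' hmE hy' (high_cube hn hyh')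
    (hrad U' hU' ⟨y', hy', hyh'⟩) hmU'
  have key : ∀ c ∈ K, u * c = m ∨ u * c = m' := by
    intro c hc
    by_contra hcon
    push Not at hcon
    have h1 : u * c ∈ U := by
      by_contra h
      exact hcon.1 (hm3 _ (by simpa using hc) h)
    have h2 : u * c ∈ U' := by
      by_contra h
      refine hcon.2 (hm3' _ ?_ h)
      rw [← mul_assoc]
      exact mul_mem (inv_mul_mem_comm.1 hm1) hc
    have := eq_of_mem hS hU hU' h1 h2
    exact hm2 (this ▸ hmU')
  have h0 : u = m' := by
    rcases key 1 (one_mem _) with h | h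
    · rw [mul_one] at h
      exact absurd (h ▸ huU) hm2
    · rwa [mul_one] at h
  have h1 : u * z = m := by
    rcases key z hzK with h | h
    · exact h
    · rw [← h0] at h
      exact absurd (mul_eq_left.1 h) D.z1
  rcases key (z ^ 2) (pow_mem hzK 2) with h | h
  · rw [← h1] at h
    exact D.zz2 (mul_left_cancel h).symm
  · rw [← h0] at h
    exact D.z2 (mul_eq_left.1 h)

lemma concl_fin (hS : IsSRing S) (D : DCtx G n z u) (hn : 2 ≤ n)
    (hrad : ∀ X ∈ S, (∃ x ∈ X, x ^ 3 ^ (n - 1) ≠ 1) → ∀ g : G, (∀ x ∈ X, g * x ∈ X) → g = 1)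
    {W : Finset G} (hW : W ∈ S) (hz : z ∈ W) {K : Subgroup G} (hK : IsU S (subgroupFinset K))
    (hKE : ∀ g ∈ K, g ^ 3 = 1 → g ∈ Subgroup.zpowers z) (hKW : ∀ g, g ∈ W ↔ g ∈ K ∧ g ≠ 1)
    {y0 : G} (hy0 : y0 ∈ K) (hy0h : y0 ^ 3 ^ (n - 1) ≠ 1) : Concl S := by
  obtain ⟨l, hl3, hlK, U, hU, hlU, hUlow⟩ := exists_low hS D hn hrad hW hz hK hKE hKW
  have hzK : z ∈ K := ((hKW z).1 hz).1
  have hCK : ∀ c ∈ Subgroup.zpowers z, c ∈ K := fun c hc => (Subgroup.zpowers_le.2 hzK) hc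
  have hlC : l ∉ Subgroup.zpowers z := fun h => hlK (hCK l h)
  have hy0W : y0 ∈ W := (hKW y0).2 ⟨hy0, fun h => hy0h (by rw [h, one_pow])⟩
  have h1W : (1 : G) ∉ W := fun h => ((hKW 1).1 h).2 rfl
  have hlam : lam U z = 0 := by
    rw [lam_eq hS (isU_of_mem hS hU) hW hz hy0W]
    rw [lam, Finset.card_eq_zero, Finset.filter_eq_empty_iff]
    intro x hx h
    have e1 := hUlow _ h
    rw [mul_pow, hUlow x hx, mul_one, inv_pow, inv_eq_one] at e1
    exact hy0h e1
  have hUz : ∀ x ∈ U, z⁻¹ * x ∉ U := by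
    rw [lam, Finset.card_eq_zero, Finset.filter_eq_empty_iff] at hlam
    exact fun x hx => hlam hx
  have hUE : ∀ x ∈ U, x ^ 3 = 1 := by
    intro x hx
    by_contra h3
    have := zinv hS D hU (k := 1) le_rfl hlU (by simpa using hl3) hx (by simpa using h3) z
      (Subgroup.mem_zpowers z)
    apply hUz _ this
    rw [mul_comm x, inv_mul_cancel_left]
    exact hx
  obtain ⟨L, hLdef⟩ : ∃ L, L = Subgroup.closure (U : Set G) := ⟨_, rfl⟩
  have hL : IsU S (subgroupFinset L) := hLdef ▸ isU_closure hS (isU_of_mem hS hU)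
  have hlL : l ∈ L := hLdef ▸ Subgroup.subset_closure hlU
  have hLE : ∀ g ∈ L, g ^ 3 = 1 := by
    intro g hg
    have hle : L ≤ E3 G := by
      rw [hLdef, Subgroup.closure_le]
      intro x hx
      exact mem_E3.2 (hUE x hx)
    exact mem_E3.1 (hle hg)
  have hzL : z ∉ L := by
    intro h
    have := hL W hW z hz (mem_sf.2 h) hy0W
    exact high_cube hn hy0h (hLE y0 (mem_sf.1 this))
  have hCL : ∀ c ∈ Subgroup.zpowers z, c ∈ L → c = 1 := by
    intro c hc hcL
    rcases (D.memC c).1 hc with h | h | h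
    · exact h
    · exact absurd (h ▸ hcL) hzL
    · refine absurd (D.sq_mem (K := L) (h := z) (h ▸ hcL)) hzL
  have hLz : L = Subgroup.zpowers l := by
    apply le_antisymm
    · intro g hg
      have hlz := Subgroup.mem_zpowers l
      rcases D.ecov' hl3 hlC (hLE g hg) with h | h | h
      · rw [hCL g h hg]; exact one_mem _
      · have := hCL _ h (mul_mem hlL hg)
        rw [eq_inv_of_mul_eq_one_right this]
        exact inv_mem hlz
      · have := hCL _ h (mul_mem (inv_mem hlL) hg)
        rw [← inv_mul_eq_one.1 this]
        exact hlz
    · exact Subgroup.zpowers_le.2 hlL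
  have hcardL : Nat.card L ≤ 3 := by
    rw [hLz, Nat.card_zpowers]
    exact orderOf_le_of_pow_eq_one (by norm_num) hl3
  have hKL : ∀ g ∈ K, g ∈ L → g = 1 := fun g hg hgL => hCL g (hKE g hg (hLE g hgL)) hgL
  have hinf : K ⊓ L = ⊥ := by
    rw [Subgroup.eq_bot_iff_forall]
    intro g hg
    exact hKL g hg.1 hg.2
  have hsup : K ⊔ L = ⊤ := by
    rw [eq_top_iff]
    intro g _
    obtain ⟨e, he3, heK⟩ := cover_E D hy0 hy0h hn g
    have hCs : ∀ c ∈ Subgroup.zpowers z, c ∈ K ⊔ L := fun c hc => Subgroup.mem_sup_left (hCK c hc)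
    have hls : l ∈ K ⊔ L := Subgroup.mem_sup_right hlL
    have he : e ∈ K ⊔ L := by
      rcases D.ecov' hl3 hlC he3 with h | h | h
      · exact hCs e h
      · exact (Subgroup.mul_mem_cancel_left _ hls).1 (hCs _ h)
      · exact (Subgroup.mul_mem_cancel_left _ (inv_mem hls)).1 (hCs _ h)
    have := mul_mem he (Subgroup.mem_sup_left (T := L) heK)
    rwa [mul_inv_cancel_left] at this
  refine ⟨K, L, hK, hL, hinf, hsup, hcardL, card_ge_three D hzK, ?_, ?_⟩
  · intro X hX hXK
    obtain ⟨x, hx⟩ := hS.nonempty X hX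
    by_cases h1 : x = 1
    · exact Or.inl (eq_of_mem hS hX hS.one_mem hx (by simp [h1]))
    · right
      have := eq_of_mem hS hX hW hx ((hKW x).2 ⟨hXK x hx, h1⟩)
      rw [this]
      exact hKW
  · intro X hX
    obtain ⟨x, hx⟩ := hS.nonempty X hX
    obtain ⟨b, hb, l1, hl1, hbl⟩ := Subgroup.mem_sup.1 (show x ∈ K ⊔ L by rw [hsup]; trivial)
    by_cases hl11 : l1 = 1
    · rw [hl11, mul_one] at hbl
      refine ⟨X, hX, {1}, hS.one_mem, ?_, by simp, by simp⟩
      intro x' hx'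
      exact mem_sf.1 (hK X hX x hx (mem_sf.2 (hbl ▸ hb)) hx')
    by_cases hb1 : b = 1
    · rw [hb1, one_mul] at hbl
      refine ⟨{1}, hS.one_mem, X, hX, by simp, ?_, by simp⟩
      intro x' hx'
      exact mem_sf.1 (hL X hX x hx (mem_sf.2 (hbl ▸ hl1)) hx')
    have hbW : b ∈ W := (hKW b).2 ⟨hb, hb1⟩
    obtain ⟨V, hV, hl1V⟩ := hS.cover l1
    have hVL : ∀ v ∈ V, v ∈ L := fun v hv => mem_sf.1 (hL V hV l1 hl1V (mem_sf.2 hl1) hv)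
    have hVX : ∀ v ∈ V, v ∉ X := by
      intro v hv hvX
      have := eq_of_mem hS hX hV hvX hv
      have hxL : x ∈ L := hVL x (this ▸ hx)
      rw [← hbl, Subgroup.mul_mem_cancel_right _ hl1] at hxL
      exact hb1 (hKL b hb hxL)
    have hall : ∀ w ∈ W, ∃ v ∈ V, w * v ∈ X := by
      intro w hw
      obtain ⟨a', ha', b', hb', he⟩ := mul_isU hS (isU_of_mem hS hX)
        (isU_inv hS (isU_of_mem hS hV)) hW (a := x) (b := l1⁻¹) (g := w) hx
        (Finset.mem_image_of_mem _ hl1V) (by rw [← hbl, mul_inv_cancel_right]; exact hbW) hw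
      obtain ⟨v, hv, rfl⟩ := Finset.mem_image.1 hb'
      exact ⟨v, hv, by rw [he, inv_mul_cancel_right]; exact ha'⟩
    have hVall : ∀ v ∈ V, ∃ w ∈ W, w * v ∈ X := by
      intro v hv
      obtain ⟨a', ha', b', hb', he⟩ := mul_isU hS (isU_of_mem hS hX)
        (isU_inv hS (isU_of_mem hS hW)) hV (a := x) (b := b⁻¹) (g := v) hx
        (Finset.mem_image_of_mem _ hbW)
        (by rw [← hbl, mul_comm b, mul_inv_cancel_right]; exact hl1V) hv
      obtain ⟨w, hw, rfl⟩ := Finset.mem_image.1 hb'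
      refine ⟨w, hw, ?_⟩
      rw [he, mul_comm w, inv_mul_cancel_right]; exact ha'
    obtain ⟨v1, hv1, hzv1⟩ := hall z hz
    obtain ⟨v2, hv2, hyv2⟩ := hall y0 hy0W
    have hz3 : (z * v1) ^ 3 = 1 := by rw [mul_pow, D.z3, hLE v1 (hVL v1 hv1), one_mul]
    have hyh : (y0 * v2) ^ 3 ^ (n - 1) ≠ 1 := by
      rw [mul_pow, pow_three_one (hLE v2 (hVL v2 hv2)) (by omega), mul_one]
      exact hy0h
    have hfull : ∀ v ∈ V, ∀ w ∈ W, w * v ∈ X := by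
      intro v hv w' hw'
      obtain ⟨w, hw, hwv⟩ := hVall v hv
      obtain ⟨m, hm1, hm2, hm3⟩ := lemJ hS D hW hz hX hK hKW hKE hzv1 hz3 hyv2 (high_cube hn hyh)
        (hrad X hX ⟨_, hyv2, hyh⟩) hwv
      have hwK : w ∈ K := ((hKW w).1 hw).1
      have hvm : v = m := by
        refine hm3 v ?_ (hVX v hv)
        rw [mul_inv, mul_assoc, inv_mul_cancel, mul_one]
        exact inv_mem hwK
      by_contra h
      have : w' * v = m := by
        refine hm3 _ ?_ h
        rw [mul_inv, mul_mul_mul_comm, inv_mul_cancel, mul_one]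
        exact mul_mem (inv_mem hwK) ((hKW w').1 hw').1
      rw [← hvm] at this
      rw [mul_eq_right.1 this] at hw'
      exact h1W hw'
    refine ⟨W, hW, V, hV, fun w hw => ((hKW w).1 hw).1, hVL, ?_⟩
    intro g
    constructor
    · intro hg
      obtain ⟨a', ha', b', hb', he⟩ := mul_isU hS (isU_of_mem hS hW) (isU_of_mem hS hV) hX
        (a := b) (b := l1) (g := g) hbW hl1V (hbl ▸ hx) hg
      exact ⟨a', ha', b', hb', he.symm⟩
    · rintro ⟨w, hw, v, hv, rfl⟩
      exact hfull v hv w hw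

lemma concl_one (hS : IsSRing S) (D : DCtx G n z u) (hn : 2 ≤ n)
    (hrad : ∀ X ∈ S, (∃ x ∈ X, x ^ 3 ^ (n - 1) ≠ 1) → ∀ g : G, (∀ x ∈ X, g * x ∈ X) → g = 1)
    {X : Finset G} (hX : X ∈ S) {x0 y : G} (hx0 : x0 ∈ X) (hx03 : x0 ^ 3 = 1) (hy : y ∈ X)
    (hyh : y ^ 3 ^ (n - 1) ≠ 1) : Concl S := by
  have hy3 := high_cube hn hyh
  have hXrad := hrad X hX ⟨y, hy, hyh⟩
  obtain ⟨W, hW, hz⟩ := hS.cover z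
  have hyC := zinv hS D hX (k := 1) le_rfl hx0 (by simpa using hx03) hy (by simpa using hy3)
  by_cases hWE : ∀ w ∈ W, w ^ 3 = 1
  · obtain ⟨hE, _⟩ := E_sub hS D hW hz hWE hX hy hyC hXrad
    have := hE X hX x0 hx0 (mem_sf.2 (mem_E3.2 hx03)) hy
    exact absurd (mem_E3.1 (mem_sf.1 this)) hy3
  push Not at hWE
  obtain ⟨y1, hy1, hy13⟩ := hWE
  obtain ⟨K, hK, ⟨hKE, hKW⟩ | ⟨hEK, v, hv3, hKW⟩⟩ := thmA hS D hW hz hy1 hy13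
  · by_cases hKh : ∃ g ∈ K, g ^ 3 ^ (n - 1) ≠ 1
    · obtain ⟨g, hg, hgh⟩ := hKh
      exact concl_fin hS D hn hrad hW hz hK hKE hKW hg hgh
    · exfalso
      push Not at hKh
      obtain ⟨m, hm1, hm2, hm3⟩ := lemJ hS D hW hz hX hK hKW hKE hx0 hx03 hy hy3 hXrad hy
      have hm : m ^ 3 ≠ 1 := by
        intro h
        have e := hKh _ hm1
        rw [mul_pow, pow_three_one h (by omega), mul_one, inv_pow, inv_eq_one] at e
        exact hyh e
      have hnot : m * z ∉ X := fun h => hm2 (zclosed hS D hX hx0 hx03 h hm)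
      have := hm3 (m * z) (by rw [← mul_assoc]; exact mul_mem hm1 ((hKW z).1 hz).1) hnot
      exact D.z1 (mul_eq_left.1 this)
  · have hyK : y ∈ K := mem_sf.1 (hK X hX x0 hx0 (mem_sf.2 (hEK x0 hx03)) hy)
    have hyW : y ∈ W := by
      refine (hKW y).2 ⟨hyK, fun h => ?_⟩
      obtain ⟨j, rfl⟩ := Subgroup.mem_zpowers_iff.1 h
      apply hy3
      rw [← zpow_natCast, ← zpow_mul, mul_comm, zpow_mul, zpow_natCast, hv3, one_zpow]
    have hXW := eq_of_mem hS hX hW hy hyW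
    have hv1 : v = 1 := by
      apply hXrad
      intro x hx
      rw [hXW, hKW] at hx ⊢
      refine ⟨mul_mem (hEK v hv3) hx.1, fun h => hx.2 ?_⟩
      exact (Subgroup.mul_mem_cancel_left _ (Subgroup.mem_zpowers v)).1 h
    refine concl_top hS D hW (fun g => ?_)
    rw [hKW, hv1, Subgroup.zpowers_one_eq_bot, Subgroup.mem_bot]
    refine ⟨fun h => h.2, fun h => ⟨?_, h⟩⟩
    obtain ⟨e, he3, he⟩ := cover_E D hyK hyh hn g
    exact (Subgroup.mul_mem_cancel_left _ (inv_mem (hEK e he3))).1 he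

/-- The main theorem in exponent form. -/
lemma concl_main (hS : IsSRing S) (D : DCtx G n z u) (hn : 2 ≤ n)
    (hrad : ∀ X ∈ S, (∃ x ∈ X, x ^ 3 ^ (n - 1) ≠ 1) → ∀ g : G, (∀ x ∈ X, g * x ∈ X) → g = 1)
    {X : Finset G} (hX : X ∈ S) {b y : G} (hb : b ∈ X) (hbl : b ^ 3 ^ (n - 1) = 1) (hy : y ∈ X)
    (hyh : y ^ 3 ^ (n - 1) ≠ 1) : Concl S := by
  have hy1 : y ≠ 1 := fun h => hyh (by rw [h, one_pow])
  have h1X := one_notMem hS hX hy hy1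
  have hex : ∃ k, ∃ x ∈ X, x ^ 3 ^ k = 1 := ⟨n - 1, b, hb, hbl⟩
  obtain ⟨k, hk⟩ : ∃ k, k = Nat.find hex := ⟨_, rfl⟩
  obtain ⟨x0, hx0, hx0k⟩ := Nat.find_spec hex
  have hmin : ∀ j < k, ∀ x ∈ X, x ^ 3 ^ j ≠ 1 := by
    intro j hj x hx h
    exact Nat.find_min hex (hk ▸ hj) ⟨x, hx, h⟩
  have hkn : k ≤ n - 1 := hk ▸ Nat.find_min' hex ⟨b, hb, hbl⟩
  rw [← hk] at hx0k
  clear hk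
  rcases k with _ | _ | k
  · rw [pow_zero, pow_one] at hx0k
    exact absurd (hx0k ▸ hx0) h1X
  · exact concl_one hS D hn hrad hX hx0 (by simpa using hx0k) hy hyh
  · exfalso
    refine KCtx.false (X := X) (k := k + 1) ⟨hX, by omega, hmin (k + 1) (by omega), hrad X hX ⟨y, hy, hyh⟩,
      ⟨x0, hx0, hx0k⟩, ⟨y, hy, ?_⟩⟩ hS D
    intro h
    apply hyh
    obtain ⟨d, hd⟩ := Nat.exists_eq_add_of_le hkn
    rw [hd, pow_add, pow_mul, h, one_pow]

end Ctx

end SR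


/-- if every highest basic set has trivial radical and some
highest basic set is nonregular, then `A = A_H ⊗ A_L` with `rk(A_H) = 2`,
`D = H × L` and `|L| ≤ 3 ≤ |H|`. -/
theorem stmt12 (n : ℕ) (hn : 2 ≤ n) (S : Finset (Finset (Dgrp n)))
    (hS : IsSRing S)
    (hrad : ∀ X ∈ S, (∃ x ∈ X, orderOf x = 3 ^ n) →
      ∀ g : Dgrp n, X.image (g * ·) = X → g = 1)
    (hex : ∃ X ∈ S, (∃ x ∈ X, orderOf x = 3 ^ n) ∧
      (∃ a ∈ X, ∃ b ∈ X, orderOf a ≠ orderOf b) ∧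
      (∀ g : Dgrp n, X.image (g * ·) = X → g = 1)) :
    ∃ H L : Subgroup (Dgrp n),
      IsASubgroup S H ∧ IsASubgroup S L ∧
      H ⊓ L = ⊥ ∧ H ⊔ L = ⊤ ∧
      Nat.card L ≤ 3 ∧ 3 ≤ Nat.card H ∧
      (∀ X ∈ S, (X : Set (Dgrp n)) ⊆ (H : Set (Dgrp n)) →
        X = ({1} : Finset (Dgrp n)) ∨ (X : Set (Dgrp n)) = (H : Set (Dgrp n)) \ {1}) ∧
      (∀ X ∈ S, ∃ X₁ ∈ S, ∃ X₂ ∈ S,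
        (X₁ : Set (Dgrp n)) ⊆ (H : Set (Dgrp n)) ∧
        (X₂ : Set (Dgrp n)) ⊆ (L : Set (Dgrp n)) ∧ X = X₁ * X₂) := by
  obtain ⟨z, u, D⟩ := SR.dctx_Dgrp n hn
  have hord : ∀ x : Dgrp n, orderOf x = 3 ^ n ↔ x ^ 3 ^ (n - 1) ≠ 1 := by
    intro x
    constructor
    · intro h h1
      have h2 := orderOf_dvd_of_pow_eq_one h1
      rw [h] at h2
      have := Nat.pow_dvd_pow_iff_le_right (x := 3) (by norm_num) |>.1 h2
      omega
    · intro h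
      have := orderOf_eq_prime_pow (p := 3) (n := n - 1) h
        (by rw [show n - 1 + 1 = n by omega]; exact D.pown x)
      rwa [show n - 1 + 1 = n by omega] at this
  have hrad' : ∀ X ∈ S, (∃ x ∈ X, x ^ 3 ^ (n - 1) ≠ 1) →
      ∀ g : Dgrp n, (∀ x ∈ X, g * x ∈ X) → g = 1 := by
    rintro X hX ⟨x, hx, hxh⟩ g hg
    refine hrad X hX ⟨x, hx, (hord x).2 hxh⟩ g ?_
    refine Finset.eq_of_subset_of_card_le ?_ ?_
    · intro a ha
      obtain ⟨b, hb, rfl⟩ := Finset.mem_image.1 ha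
      exact hg b hb
    · rw [Finset.card_image_of_injective _ (mul_right_injective g)]
  obtain ⟨X, hX, ⟨y, hy, hyo⟩, ⟨a, ha, b, hb, hab⟩, _⟩ := hex
  have hlow : ∃ c ∈ X, c ^ 3 ^ (n - 1) = 1 := by
    by_contra hcon
    push Not at hcon
    exact hab (((hord a).2 (hcon a ha)).trans ((hord b).2 (hcon b hb)).symm)
  obtain ⟨c, hc, hcl⟩ := hlow
  obtain ⟨H, L, h1, h2, h3, h4, h5, h6, h7, h8⟩ :=
    SR.concl_main hS D hn hrad' hX hc hcl hy ((hord y).1 hyo)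
  refine ⟨H, L, (SR.isU_iff hS _).2 h1, (SR.isU_iff hS _).2 h2, h3, h4, h5, h6, ?_, ?_⟩
  · intro Y hY hYH
    rcases h7 Y hY (fun x hx => hYH hx) with h | h
    · left
      rw [h]
    · right
      ext g
      simp only [Finset.mem_coe, Set.mem_diff, SetLike.mem_coe, Set.mem_singleton_iff]
      exact h g
  · intro Y hY
    obtain ⟨X₁, hX₁, X₂, hX₂, hH, hL, h⟩ := h8 Y hY
    refine ⟨X₁, hX₁, X₂, hX₂, fun x hx => hH x hx, fun x hx => hL x hx, ?_⟩
    ext g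
    rw [Finset.mem_mul]
    exact h g
end
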